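/- arXiv:2207.03759 — 10 statements merged into one kernel-verified Lean document; each statement's English description precedes it below -/
import Mathlib

section
/- The polynomial Y^(q+1) − (t^q − 2·t^((q+1)/2) + t) is irreducible over the rational function field k(t), and the field L = k(t)[Y]/(Y^(q+1) − (t^q − 2·t^((q+1)/2) + t)) is a Galois extension of k(t) whose Galois group is cyclic of order q+1. -/
open IntermediateField Polynomial

/-- If `a` vanishes to order exactly one at `0`, then `Y ^ m - a` is irreducible over `k(t)`. -/
theorem irreducible_X_pow_sub_C_algebraMap {k : Type*} [Field k] {m : ℕ} (hm : m ≠ 0) {a : k[X]}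
    (h0 : a.coeff 0 = 0) (h1 : a.coeff 1 ≠ 0) :
    Irreducible (X ^ m - C (algebraMap k[X] (RatFunc k) a) : (RatFunc k)[X]) := by
  have hmonic : (X ^ m - C a : k[X][X]).Monic := monic_X_pow_sub_C a hm
  have hdeg : (X ^ m - C a : k[X][X]).degree = m :=
    degree_X_pow_sub_C (Nat.pos_of_ne_zero hm) a
  have hirr : Irreducible (X ^ m - C a : k[X][X]) := by
    have hprime : (Ideal.span {(X : k[X])}).IsPrime :=
      (Ideal.span_singleton_prime X_ne_zero).2 prime_X
    refine irreducible_of_eisenstein_criterion hprime ?_ ?_ ?_ ?_ hmonic.isPrimitive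
    · rw [hmonic.leadingCoeff]
      exact fun h ↦ hprime.ne_top ((Ideal.eq_top_iff_one _).2 h)
    · intro i hi
      rw [hdeg, Nat.cast_lt] at hi
      rw [Ideal.mem_span_singleton, X_dvd_iff, coeff_sub, coeff_X_pow, if_neg hi.ne, coeff_C]
      split_ifs <;> simp [h0]
    · rw [hdeg]
      exact_mod_cast Nat.pos_of_ne_zero hm
    · rw [Ideal.span_singleton_pow, Ideal.mem_span_singleton, X_pow_dvd_iff]
      intro h
      have := h 1 (by norm_num)
      simp [coeff_X_pow, hm.symm, h1] at this
  have := (hmonic.irreducible_iff_irreducible_map_fraction_map (K := RatFunc k)).1 hirr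
  simpa using this

/-- Over `k(t)` (with `k` algebraically closed of odd characteristic `p`,
`q = p ^ n ≥ 5`), the polynomial `Y ^ (q+1) - (t ^ q - 2 t ^ ((q+1)/2) + t)` is irreducible,
and the field `L = k(t)[Y]/(Y ^ (q+1) - (t ^ q - 2 t ^ ((q+1)/2) + t))` is a Galois extension
of `k(t)` with cyclic Galois group of order `q + 1`. -/
theorem stmt_1
    (k : Type*) [Field k] [IsAlgClosed k]
    (p : ℕ) [Fact p.Prime] (hp2 : p ≠ 2) [CharP k p]
    (n q : ℕ) (hq : q = p ^ n) (hq5 : 5 ≤ q)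
    (L : Type*) [Field L] [Algebra (RatFunc k) L]
    (y : L)
    (hy : y ^ (q + 1) = algebraMap (RatFunc k) L
        (RatFunc.X ^ q - 2 * RatFunc.X ^ ((q + 1) / 2) + RatFunc.X))
    (hgen : adjoin (RatFunc k) {y} = ⊤) :
    Irreducible (X ^ (q + 1)
        - C (RatFunc.X ^ q - 2 * RatFunc.X ^ ((q + 1) / 2) + RatFunc.X)
          : Polynomial (RatFunc k))
      ∧ IsGalois (RatFunc k) L
      ∧ IsCyclic (L ≃ₐ[RatFunc k] L)
      ∧ Nat.card (L ≃ₐ[RatFunc k] L) = q + 1 := by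
  have hirr : Irreducible (X ^ (q + 1)
      - C (RatFunc.X ^ q - 2 * RatFunc.X ^ ((q + 1) / 2) + RatFunc.X)
        : Polynomial (RatFunc k)) := by
    have h := irreducible_X_pow_sub_C_algebraMap (k := k) (m := q + 1) q.succ_ne_zero
      (a := X ^ q - C 2 * X ^ ((q + 1) / 2) + X)
      (by simp only [coeff_add, coeff_sub, coeff_C_mul, coeff_X_pow, coeff_X]
          rw [if_neg (by omega), if_neg (by omega)]
          simp)
      (by simp only [coeff_add, coeff_sub, coeff_C_mul, coeff_X_pow, coeff_X]
          rw [if_neg (by omega), if_neg (by omega)]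
          simp)
    simpa [show RatFunc.C (2 : k) = 2 from map_ofNat _ 2] using h
  have hqk : (q : k) = 0 := by
    rw [CharP.cast_eq_zero_iff k p, hq]
    exact dvd_pow_self p (by rintro rfl; simp at hq; omega)
  have : NeZero ((q + 1 : ℕ) : k) := ⟨by simp [hqk]⟩
  obtain ⟨ζ, hζ⟩ := HasEnoughRootsOfUnity.exists_primitiveRoot k (q + 1)
  have hprim : (primitiveRoots (q + 1) (RatFunc k)).Nonempty :=
    ⟨algebraMap k (RatFunc k) ζ, (mem_primitiveRoots q.succ_pos).2
      (hζ.map_of_injective (algebraMap k (RatFunc k)).injective)⟩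
  have hint : IsIntegral (RatFunc k) y :=
    IsIntegral.of_pow q.succ_pos (hy ▸ isIntegral_algebraMap)
  have hfin : FiniteDimensional (RatFunc k) L := by
    have := adjoin.finiteDimensional hint
    rw [hgen] at this
    exact topEquiv.toLinearEquiv.finiteDimensional
  have hfinrank : Module.finrank (RatFunc k) L = q + 1 := by
    have hmin := minpoly.eq_of_irreducible_of_monic hirr (x := y) (by simp [hy])
      (monic_X_pow_sub_C _ q.succ_ne_zero)
    rw [← finrank_top', ← hgen, adjoin.finrank hint, ← hmin, natDegree_X_pow_sub_C]
  have hsplit : IsSplittingField (RatFunc k) L (X ^ (q + 1)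
      - C (RatFunc.X ^ q - 2 * RatFunc.X ^ ((q + 1) / 2) + RatFunc.X)) := by
    have h := isSplittingField_X_pow_sub_C_of_root_adjoin_eq_top (K := RatFunc k) (L := L)
      (hfinrank.symm ▸ hprim) (hfinrank.symm ▸ hy) hgen
    rwa [hfinrank] at h
  have hgal := isGalois_of_isSplittingField_X_pow_sub_C hprim hirr L
  exact ⟨hirr, hgal, isCyclic_of_isSplittingField_X_pow_sub_C hprim hirr L,
    (IsGalois.card_aut_eq_finrank _ _).trans hfinrank⟩
end

section
/- Let α ∈ k satisfy α^(q²) = α and α^q ≠ α (an element of F_{q²} \ F_q inside k), and set u = (x² − α^(q+1)) / (x − (α + α^q)/2) ∈ F. Then F is a finite Galois extension of the intermediate field k⟮u⟯ generated by k and u, and Gal(F/k⟮u⟯) is isomorphic to the direct product of a cyclic group of order (q+1)/2 and a cyclic group of order 2. -/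
open IntermediateField Polynomial

/-- A finite group of order at most `m * n` containing commuting elements of orders `m` and `n`
that generate disjoint subgroups is a product of two cyclic groups. -/
lemma nonempty_mulEquiv_prod_of_commute {H : Type*} [Group H] [Finite H] {r s : H} {m n : ℕ}
    (hr : orderOf r = m) (hs : orderOf s = n) (hc : Commute r s)
    (hd : Disjoint (Subgroup.zpowers r) (Subgroup.zpowers s)) (hcard : Nat.card H ≤ m * n) :
    Nonempty (H ≃* (Multiplicative (ZMod m) × Multiplicative (ZMod n))) := by
  subst hr hs
  rw [← Nat.card_zpowers, ← Nat.card_zpowers] at hcard ⊢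
  let f : Subgroup.zpowers r × Subgroup.zpowers s →* H :=
    (Subgroup.zpowers r).subtype.noncommCoprod (Subgroup.zpowers s).subtype (by
      rintro ⟨_, i, rfl⟩ ⟨_, j, rfl⟩
      exact (hc.zpow_left i).zpow_right j)
  have hf : Function.Injective f := by
    rw [MonoidHom.noncommCoprod_injective]
    refine ⟨Subgroup.subtype_injective _, Subgroup.subtype_injective _, ?_⟩
    rwa [Subgroup.range_subtype, Subgroup.range_subtype]
  have hb : Function.Bijective f :=
    hf.bijective_of_nat_card_le (by rwa [Nat.card_prod])
  exact ⟨(MulEquiv.ofBijective f hb).symm.trans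
    (MulEquiv.prodCongr (zmodCyclicMulEquiv inferInstance).symm
      (zmodCyclicMulEquiv inferInstance).symm)⟩

/-- The degree of an extension generated by two elements is at most the product of the degrees of
monic polynomials which these elements annihilate successively. -/
lemma finiteDimensional_and_finrank_le_of_adjoin_pair {K F : Type*} [Field K] [Field F]
    [Algebra K F] {x y : F} (hgen : adjoin K {x, y} = ⊤) {P : K[X]} (hP : P.Monic)
    (hPx : aeval x P = 0) {Q : K⟮x⟯[X]} (hQ : Q.Monic) (hQy : aeval y Q = 0) :
    FiniteDimensional K F ∧ Module.finrank K F ≤ P.natDegree * Q.natDegree := by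
  have hxi : IsIntegral K x := ⟨P, hP, hPx⟩
  have hyi : IsIntegral K⟮x⟯ y := ⟨Q, hQ, hQy⟩
  have htop : K⟮x⟯⟮y⟯ = ⊤ := by
    apply IntermediateField.restrictScalars_injective K
    rw [adjoin_simple_adjoin_simple, hgen, IntermediateField.restrictScalars_top]
  have : FiniteDimensional K K⟮x⟯ := adjoin.finiteDimensional hxi
  have : FiniteDimensional K⟮x⟯ F := by
    have := adjoin.finiteDimensional hyi
    rw [htop] at this
    exact Module.Finite.equiv (IntermediateField.topEquiv (F := K⟮x⟯) (E := F)).toLinearEquiv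
  refine ⟨FiniteDimensional.trans K K⟮x⟯ F, ?_⟩
  rw [← Module.finrank_mul_finrank K K⟮x⟯ F, adjoin.finrank hxi,
    ← IntermediateField.finrank_top' (F := K⟮x⟯) (E := F), ← htop, adjoin.finrank hyi]
  exact Nat.mul_le_mul (natDegree_le_natDegree (minpoly.min K x hP hPx))
    (natDegree_le_natDegree (minpoly.min _ y hQ hQy))

section CurveFunctionField

variable {k : Type*} [Field k]

lemma irreducible_X_pow_sub_C_map_ratFunc {m q : ℕ} (hm : 0 < m) (hq : 1 < q) :
    Irreducible (X ^ m - C (algebraMap k[X] (RatFunc k) (X ^ q - X)) : (RatFunc k)[X]) := by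
  have hmon : (X ^ m - C (X ^ q - X) : k[X][X]).Monic := monic_X_pow_sub_C _ hm.ne'
  have hprime : (Ideal.span {(X : k[X])}).IsPrime :=
    (Ideal.span_singleton_prime X_ne_zero).2 prime_X
  have hmain : Irreducible (X ^ m - C (X ^ q - X) : k[X][X]) := by
    refine IsEisensteinAt.irreducible (𝓟 := Ideal.span {(X : k[X])}) ⟨?_, ?_, ?_⟩ hprime
      hmon.isPrimitive (by rwa [natDegree_X_pow_sub_C])
    · rw [hmon.leadingCoeff, ← Ideal.ne_top_iff_one]
      exact hprime.ne_top
    · intro i hi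
      rw [natDegree_X_pow_sub_C] at hi
      rw [coeff_sub, coeff_X_pow, if_neg hi.ne, coeff_C, zero_sub, neg_mem_iff]
      split_ifs
      · rw [Ideal.mem_span_singleton]
        exact dvd_sub (dvd_pow_self _ (by lia)) dvd_rfl
      · exact zero_mem _
    · rw [coeff_sub, coeff_X_pow, if_neg hm.ne, coeff_C_zero, zero_sub, neg_mem_iff,
        Ideal.span_singleton_pow, Ideal.mem_span_singleton, X_pow_dvd_iff]
      intro h
      have := h 1 one_lt_two
      rw [coeff_sub, coeff_X_pow, if_neg hq.ne, coeff_X_one] at this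
      simp at this
  have := (hmon.irreducible_iff_irreducible_map_fraction_map (K := RatFunc k)).1 hmain
  simpa using this

variable {F : Type*} [Field F] [Algebra k F]

lemma algHom_ext_of_adjoin_pair_eq_top {x y : F} (hgen : adjoin k {x, y} = ⊤)
    {f g : F →ₐ[k] F} (h₁ : f x = g x) (h₂ : f y = g y) : f = g := by
  ext z
  have hz : z ∈ adjoin k {x, y} := hgen ▸ IntermediateField.mem_top
  induction hz using IntermediateField.adjoin_induction with
  | mem z hz =>
    rcases hz with rfl | rfl
    exacts [h₁, h₂]
  | algebraMap z => simp
  | add a b _ _ ha hb => simp [ha, hb]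
  | inv a _ ha => simp [ha]
  | mul a b _ _ ha hb => simp [ha, hb]

/-- The universal map from the function field of `y ^ m = x ^ q - x`. -/
lemma exists_algHom_adjoinRoot {m q : ℕ} {x y : F} (hx : Transcendental k x)
    (hxy : y ^ m = x ^ q - x) :
    ∃ f : AdjoinRoot (X ^ m - C (algebraMap k[X] (RatFunc k) (X ^ q - X))) →ₐ[k] F,
      f (AdjoinRoot.of _ RatFunc.X) = x ∧ f (AdjoinRoot.root _) = y := by
  have hinj := transcendental_iff_injective.1 hx
  let g : RatFunc k →ₐ[k] F := IsFractionRing.liftAlgHom (A := k[X]) (g := aeval x) hinj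
  have hg : ∀ P : k[X], g (algebraMap k[X] (RatFunc k) P) = aeval x P := fun P ↦
    IsFractionRing.lift_algebraMap (A := k[X]) (g := (aeval x : k[X] →ₐ[k] F).toRingHom) hinj P
  refine ⟨AdjoinRoot.liftAlgHom _ g y ?_, ?_, AdjoinRoot.liftAlgHom_root _ _ _ _⟩
  · rw [eval₂_sub, eval₂_pow, eval₂_X, eval₂_C, RingHom.coe_coe, hg, hxy]
    simp
  · rw [AdjoinRoot.liftAlgHom_of, ← RatFunc.algebraMap_X, hg, aeval_X]

/-- Any point of the curve `y ^ m = x ^ q - x` with transcendental abscissa induces an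
endomorphism of its function field. -/
lemma exists_algHom_of_curve_eq {m q : ℕ} (hm : 0 < m) (hq : 1 < q) {x y x' y' : F}
    (hx : Transcendental k x) (hxy : y ^ m = x ^ q - x) (hgen : adjoin k {x, y} = ⊤)
    (hx' : Transcendental k x') (hxy' : y' ^ m = x' ^ q - x') :
    ∃ f : F →ₐ[k] F, f x = x' ∧ f y = y' := by
  have : Fact (Irreducible (X ^ m - C (algebraMap k[X] (RatFunc k) (X ^ q - X)))) :=
    ⟨irreducible_X_pow_sub_C_map_ratFunc hm hq⟩
  obtain ⟨f, hfx, hfy⟩ := exists_algHom_adjoinRoot hx hxy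
  obtain ⟨g, hgx, hgy⟩ := exists_algHom_adjoinRoot hx' hxy'
  have hf : Function.Surjective f := by
    rw [← AlgHom.fieldRange_eq_top, eq_top_iff, ← hgen, adjoin_le_iff]
    rintro z (rfl | rfl)
    exacts [⟨_, hfx⟩, ⟨_, hfy⟩]
  let e := AlgEquiv.ofBijective f ⟨f.toRingHom.injective, hf⟩
  refine ⟨g.comp e.symm.toAlgHom, ?_, ?_⟩
  · have : e.symm x = AdjoinRoot.of _ RatFunc.X := by rw [AlgEquiv.symm_apply_eq]; exact hfx.symm
    simp [this, hgx]
  · have : e.symm y = AdjoinRoot.root _ := by rw [AlgEquiv.symm_apply_eq]; exact hfy.symm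
    simp [this, hgy]

lemma transcendental_add_mul_inv_sub {x : F} (hx : Transcendental k x) (b c : k) (hb : b ≠ 0) :
    Transcendental k (algebraMap k F c + algebraMap k F b / (x - algebraMap k F c)) := by
  intro h
  refine hx ?_
  have h' := ((isAlgebraic_algebraMap (A := F) b).mul
    (h.sub (isAlgebraic_algebraMap (A := F) c)).inv).add (isAlgebraic_algebraMap (A := F) c)
  have hb' : algebraMap k F b ≠ 0 := by simpa using hb
  rwa [add_sub_cancel_left, inv_div, mul_div_cancel₀ _ hb', sub_add_cancel] at h'

/-- The equation of the curve `y ^ m = x ^ q - x` is preserved by the involution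
`(x, y) ↦ (c + b ^ 2 / (x - c), b ^ 2 * y / (x - c) ^ 2)`. -/
lemma curve_eq_involution {p n m q : ℕ} [Fact p.Prime] [CharP F p] (hq : q = p ^ n)
    (hm : 2 * m = q + 1) {x y b c : F} (hxy : y ^ m = x ^ q - x) (hc : c ^ q = c)
    (hb : b ^ q = -b) (hxc : x - c ≠ 0) :
    (b ^ 2 * y / (x - c) ^ 2) ^ m = (c + b ^ 2 / (x - c)) ^ q - (c + b ^ 2 / (x - c)) := by
  have hxq : (x - c) ^ q = x ^ q - c := by
    conv_rhs => rw [← hc]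
    rw [hq, sub_pow_char_pow]
  have hadd : ∀ z w : F, (z + w) ^ q = z ^ q + w ^ q := fun z w ↦ by
    rw [hq, add_pow_char_pow]
  rw [hadd, hc, div_pow, div_pow, mul_pow, ← pow_mul, ← pow_mul, hm, pow_succ, pow_succ, hb,
    hxy, ← pow_mul, mul_comm 2 q, pow_mul, hb, hxq]
  have hxq0 : x ^ q - c ≠ 0 := hxq ▸ pow_ne_zero _ hxc
  field_simp
  ring

/-- The automorphism of the function field of `y ^ m = x ^ q - x` fixing `x` and multiplying
`y` by an `m`-th root of unity. -/
lemma exists_algEquiv_mul_root {m q : ℕ} (hm : 0 < m) (hq : 1 < q) {x y : F}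
    (hx : Transcendental k x) (hxy : y ^ m = x ^ q - x) (hgen : adjoin k {x, y} = ⊤)
    {ζ : k} (hζ : ζ ^ m = 1) :
    ∃ r : F ≃ₐ[k] F, r x = x ∧ r y = algebraMap k F ζ * y := by
  have hζ0 : algebraMap k F ζ ≠ 0 := by
    rw [_root_.map_ne_zero]
    rintro rfl
    simp [hm.ne'] at hζ
  have key : ∀ ξ : k, ξ ^ m = 1 → (algebraMap k F ξ * y) ^ m = x ^ q - x := fun ξ hξ ↦ by
    rw [mul_pow, ← map_pow, hξ, map_one, one_mul, hxy]
  obtain ⟨f, hfx, hfy⟩ := exists_algHom_of_curve_eq hm hq hx hxy hgen hx (key ζ hζ)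
  obtain ⟨g, hgx, hgy⟩ := exists_algHom_of_curve_eq hm hq hx hxy hgen hx
    (key ζ⁻¹ (by rw [inv_pow, hζ, inv_one]))
  refine ⟨AlgEquiv.ofAlgHom f g ?_ ?_, hfx, hfy⟩ <;>
    apply algHom_ext_of_adjoin_pair_eq_top hgen <;> simp [hfx, hfy, hgx, hgy, hζ0]

/-- The involution `(x, y) ↦ (c + b ^ 2 / (x - c), b ^ 2 * y / (x - c) ^ 2)` as an automorphism of
the function field of `y ^ m = x ^ q - x`. -/
lemma exists_algEquiv_involution {p n m q : ℕ} [Fact p.Prime] [CharP F p] (hpq : q = p ^ n)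
    (hmq : 2 * m = q + 1) (hm : 0 < m) (hq : 1 < q) {x y : F}
    (hx : Transcendental k x) (hxy : y ^ m = x ^ q - x) (hgen : adjoin k {x, y} = ⊤)
    {b c : k} (hb0 : b ≠ 0) (hc : c ^ q = c) (hb : b ^ q = -b) :
    ∃ s : F ≃ₐ[k] F, s x = algebraMap k F c + algebraMap k F b ^ 2 / (x - algebraMap k F c) ∧
      s y = algebraMap k F b ^ 2 * y / (x - algebraMap k F c) ^ 2 ∧ ∀ z, s (s z) = z := by
  have hxc : x - algebraMap k F c ≠ 0 := fun h ↦
    hx (by rw [sub_eq_zero.1 h]; exact isAlgebraic_algebraMap c)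
  have hb0' : algebraMap k F b ≠ 0 := by simpa using hb0
  have hx' := transcendental_add_mul_inv_sub hx (b ^ 2) c (pow_ne_zero 2 hb0)
  rw [map_pow] at hx'
  obtain ⟨f, hfx, hfy⟩ := exists_algHom_of_curve_eq hm hq hx hxy hgen hx'
    (curve_eq_involution hpq hmq hxy (by rw [← map_pow, hc]) (by rw [← map_pow, hb, map_neg]) hxc)
  have hff : f.comp f = AlgHom.id k F := by
    apply algHom_ext_of_adjoin_pair_eq_top hgen
    · simp only [AlgHom.comp_apply, hfx, map_add, map_div₀, map_sub, map_pow, AlgHom.commutes,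
        AlgHom.id_apply]
      field_simp
      ring
    · simp only [AlgHom.comp_apply, hfx, hfy, map_mul, map_div₀, map_sub, map_pow,
        AlgHom.commutes, AlgHom.id_apply]
      field_simp
      rw [add_sub_cancel_left]
      field_simp
  exact ⟨AlgEquiv.ofAlgHom f f hff hff, hfx, hfy, fun z ↦ DFunLike.congr_fun hff z⟩

/-- If `r` multiplies `y` by a primitive `m`-th root of unity and fixes `x`, while `s` is an
involution moving `x`, then a group of automorphisms of `k(x, y)` of order at most `2 * m`
containing `r` and `s` is a product of cyclic groups of orders `m` and `2`. -/
lemma nonempty_mulEquiv_prod_of_generators {K : IntermediateField k F} [FiniteDimensional K F]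
    {m : ℕ} {x y : F} (hgen : adjoin k {x, y} = ⊤) (hy : y ≠ 0)
    {ζ : k} (hζ : IsPrimitiveRoot ζ m) {r s : F ≃ₐ[K] F} (hrx : r x = x)
    (hry : r y = algebraMap k F ζ * y) (hsx : s x ≠ x) (hs : ∀ z, s (s z) = z)
    (hc : r (s x) = s (r x)) (hc' : r (s y) = s (r y)) (hcard : Nat.card (F ≃ₐ[K] F) ≤ m * 2) :
    Nonempty ((F ≃ₐ[K] F) ≃* (Multiplicative (ZMod m) × Multiplicative (ZMod 2))) := by
  have hext : ∀ f g : F ≃ₐ[K] F, f x = g x → f y = g y → f = g := fun f g h₁ h₂ ↦ by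
    have := algHom_ext_of_adjoin_pair_eq_top hgen (f := f.toAlgHom.restrictScalars k)
      (g := g.toAlgHom.restrictScalars k) h₁ h₂
    ext z
    exact DFunLike.congr_fun this z
  have hrζ : r (algebraMap k F ζ) = algebraMap k F ζ := by
    rw [IsScalarTower.algebraMap_apply k K F, r.commutes]
  have hpx : ∀ i : ℕ, (r ^ i) x = x := fun i ↦ by
    induction i with
    | zero => simp
    | succ i ih => rw [pow_succ', AlgEquiv.mul_apply, ih, hrx]
  have hpy : ∀ i : ℕ, (r ^ i) y = algebraMap k F (ζ ^ i) * y := fun i ↦ by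
    induction i with
    | zero => simp
    | succ i ih =>
      rw [pow_succ', AlgEquiv.mul_apply, ih, map_mul, map_pow, map_pow, hrζ, hry,
        ← map_pow, pow_succ, map_mul, mul_assoc]
  have hs2 : s ^ 2 = 1 := by
    ext z
    rw [pow_two]
    exact hs z
  refine nonempty_mulEquiv_prod_of_commute (r := r) (s := s) ?_ ?_ ?_ ?_ hcard
  · rw [hζ.eq_orderOf, orderOf_eq_orderOf_iff]
    intro i
    constructor
    · intro h
      have := hpy i
      rw [h, AlgEquiv.one_apply, eq_comm, mul_eq_right₀ hy] at this
      exact (algebraMap k F).injective (this.trans (map_one _).symm)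
    · intro h
      exact hext _ _ (hpx i) (by rw [hpy, h]; simp)
  · refine orderOf_eq_prime hs2 ?_
    rintro rfl
    exact hsx rfl
  · exact hext _ _ hc hc'
  · rw [Subgroup.disjoint_def]
    intro g hr hg
    have hgx : g x = x := by
      have : Subgroup.zpowers r ≤ MulAction.stabilizer (F ≃ₐ[K] F) x :=
        Subgroup.zpowers_le.2 hrx
      exact this hr
    obtain ⟨i, rfl⟩ := hg
    obtain ⟨j, rfl | rfl⟩ := Int.even_or_odd' i
    · simp [zpow_mul, hs2]
    · exact absurd (by simpa [zpow_add, zpow_mul, hs2] using hgx) hsx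

end CurveFunctionField

/-- Let `α ∈ 𝔽_{q²} \ 𝔽_q` inside `k`, and set
`u = (x² - α^(q+1)) / (x - (α + α^q)/2) ∈ F`.  Then `F` is a finite Galois extension of
`k⟮u⟯`, and `Gal(F/k⟮u⟯) ≅ C_{(q+1)/2} × C₂`. -/
theorem stmt_3
    (k : Type*) [Field k] [IsAlgClosed k]
    (p : ℕ) [Fact p.Prime] (hp2 : p ≠ 2) [CharP k p]
    (n q : ℕ) (hq : q = p ^ n) (hq5 : 5 ≤ q)
    (F : Type*) [Field F] [Algebra k F]
    (x y : F) (hx : Transcendental k x)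
    (hxy : y ^ ((q + 1) / 2) = x ^ q - x)
    (hgen : adjoin k {x, y} = ⊤)
    (α : k) (hα : α ^ q ^ 2 = α) (hα' : α ^ q ≠ α)
    (A : F) (hA : A = algebraMap k F α)
    (u : F) (hu : u = (x ^ 2 - A ^ (q + 1)) / (x - (A + A ^ q) / 2)) :
    FiniteDimensional k⟮u⟯ F ∧ IsGalois k⟮u⟯ F ∧
      Nonempty ((F ≃ₐ[k⟮u⟯] F) ≃*
        (Multiplicative (ZMod ((q + 1) / 2)) × Multiplicative (ZMod 2))) := by
  have hp : p.Prime := Fact.out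
  have : CharP F p := charP_of_injective_algebraMap (algebraMap k F).injective p
  have hqodd : Odd q := hq ▸ (hp.odd_of_ne_two hp2).pow
  have hmq : 2 * ((q + 1) / 2) = q + 1 := Nat.mul_div_cancel' hqodd.add_one.two_dvd
  generalize (q + 1) / 2 = m at *
  have hm : 0 < m := by lia
  have hq1 : 1 < q := by lia
  have h2 : (2 : k) ≠ 0 := Ring.two_ne_zero (by rwa [ringChar.eq k p])
  have h2F : (2 : F) ≠ 0 := Ring.two_ne_zero (by rwa [ringChar.eq F p])
  have hq0 : (q : k) = 0 := by
    rw [CharP.cast_eq_zero_iff k p, hq]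
    refine dvd_pow_self p ?_
    rintro rfl
    lia
  have : NeZero (m : k) := ⟨fun h ↦ by
    have := congrArg (Nat.cast (R := k)) hmq
    simp [h, hq0] at this⟩
  obtain ⟨ζ, hζ⟩ := HasEnoughRootsOfUnity.exists_primitiveRoot k m
  have hadd : ∀ z w : k, (z + w) ^ q = z ^ q + w ^ q := fun z w ↦ by
    rw [hq, add_pow_char_pow]
  have hsub : ∀ z w : k, (z - w) ^ q = z ^ q - w ^ q := fun z w ↦ by
    rw [hq, sub_pow_char_pow]
  have h2q : (2 : k) ^ q = 2 := by rw [← one_add_one_eq_two, hadd, one_pow]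
  have hαq : (α ^ q) ^ q = α := by rw [← pow_mul, ← pow_two, hα]
  obtain ⟨c, hc⟩ : ∃ c, c = (α + α ^ q) / 2 := ⟨_, rfl⟩
  obtain ⟨b, hb⟩ : ∃ b, b = (α - α ^ q) / 2 := ⟨_, rfl⟩
  have hcq : c ^ q = c := by rw [hc, div_pow, hadd, hαq, h2q, add_comm]
  have hbq : b ^ q = -b := by rw [hb, div_pow, hsub, hαq, h2q, ← neg_div, neg_sub]
  have hb0 : b ≠ 0 := by
    rw [hb]
    exact div_ne_zero (sub_ne_zero.2 hα'.symm) h2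
  have hcF : (A + A ^ q) / 2 = algebraMap k F c := by
    simp only [hc, hA, map_div₀, map_add, map_pow, map_ofNat]
  have hN : A ^ (q + 1) = algebraMap k F c ^ 2 - algebraMap k F b ^ 2 := by
    simp only [hc, hb, hA, map_div₀, map_add, map_sub, map_pow, map_ofNat]
    field_simp
    ring
  rw [hcF, hN] at hu
  have hxne : ∀ d : k, x - algebraMap k F d ≠ 0 := fun d h ↦
    hx (by rw [sub_eq_zero.1 h]; exact isAlgebraic_algebraMap d)
  have hxc := hxne c
  have hy : y ≠ 0 := by
    rintro rfl
    rw [zero_pow hm.ne', eq_comm] at hxy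
    refine hx ⟨X ^ q - X, ?_, by simp [hxy]⟩
    exact FiniteField.X_pow_card_sub_X_ne_zero k hq1
  obtain ⟨r, hrx, hry⟩ := exists_algEquiv_mul_root hm hq1 hx hxy hgen hζ.pow_eq_one
  obtain ⟨s, hsx, hsy, hss⟩ :=
    exists_algEquiv_involution hq hmq hm hq1 hx hxy hgen hb0 hcq hbq
  have hux : u = x + s x := by
    rw [hu, hsx]
    field_simp
    ring
  have hru : r u = u := by simp [hux, hsx, hrx]
  have hsu : s u = u := by rw [hux, map_add, hss, add_comm]
  have hfix : ∀ g : F ≃ₐ[k] F, g u = u → g ∈ k⟮u⟯.fixingSubgroup := fun g hg z ↦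
    (IntermediateField.forall_mem_adjoin_smul_eq_self_iff k g).2
      (by rintro _ rfl; exact hg) z.1 z.2
  let r' : F ≃ₐ[k⟮u⟯] F := fixingSubgroupEquiv k⟮u⟯ ⟨r, hfix r hru⟩
  let s' : F ≃ₐ[k⟮u⟯] F := fixingSubgroupEquiv k⟮u⟯ ⟨s, hfix s hsu⟩
  have hgen' : adjoin k⟮u⟯ {x, y} = ⊤ := by
    apply IntermediateField.restrictScalars_injective k
    rw [IntermediateField.restrictScalars_top, eq_top_iff, ← hgen, adjoin_le_iff]
    exact subset_adjoin k⟮u⟯ {x, y}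
  let P : k⟮u⟯[X] := X ^ 2 - C (AdjoinSimple.gen k u) * X +
    C (AdjoinSimple.gen k u * algebraMap k _ c - algebraMap k _ (c ^ 2 - b ^ 2))
  have hPdeg : P.natDegree = 2 := by unfold P; compute_degree!
  have hP : P.Monic := by unfold P; monicity!
  have hPx : aeval x P = 0 := by
    have hgu : algebraMap k⟮u⟯ F (AdjoinSimple.gen k u) = u := rfl
    simp only [P, map_add, map_sub, map_mul, map_pow, aeval_X, aeval_C, hgu,
      ← IsScalarTower.algebraMap_apply k k⟮u⟯ F]
    rw [hu]
    field_simp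
    ring
  let Q : k⟮u⟯⟮x⟯[X] := X ^ m - C (AdjoinSimple.gen k⟮u⟯ x ^ q - AdjoinSimple.gen k⟮u⟯ x)
  have hQdeg : Q.natDegree = m := natDegree_X_pow_sub_C
  have hQ : Q.Monic := monic_X_pow_sub_C _ hm.ne'
  have hQy : aeval y Q = 0 := by
    have hgx : algebraMap k⟮u⟯⟮x⟯ F (AdjoinSimple.gen k⟮u⟯ x) = x := rfl
    simp [Q, hgx, hxy]
  obtain ⟨hfin, hrank⟩ := finiteDimensional_and_finrank_le_of_adjoin_pair hgen' hP hPx hQ hQy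
  rw [hPdeg, hQdeg, mul_comm] at hrank
  have hcard : Nat.card (F ≃ₐ[k⟮u⟯] F) ≤ Module.finrank k⟮u⟯ F := by
    rw [Nat.card_eq_fintype_card]
    exact AlgEquiv.card_le
  have hsx' : s x ≠ x := by
    intro h
    have : (x - algebraMap k F (c + b)) * (x - algebraMap k F (c - b)) = 0 := by
      rw [hsx] at h
      field_simp at h
      simp only [map_add, map_sub]
      linear_combination -h
    rcases mul_eq_zero.1 this with h | h <;> exact hxne _ h
  have hprod : Nonempty ((F ≃ₐ[k⟮u⟯] F) ≃*
      (Multiplicative (ZMod m) × Multiplicative (ZMod 2))) :=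
    nonempty_mulEquiv_prod_of_generators (r := r') (s := s') hgen hy hζ hrx hry hsx' hss
      (show r (s x) = s (r x) by simp [hsx, hrx])
      (show r (s y) = s (r y) by
        simp only [hsy, hry, hrx, map_mul, map_div₀, map_pow, map_sub, AlgEquiv.commutes]
        ring)
      (hcard.trans hrank)
  refine ⟨hfin, IsGalois.of_card_aut_eq_finrank _ _ (le_antisymm hcard ?_), hprod⟩
  obtain ⟨e⟩ := hprod
  refine hrank.trans_eq ?_
  rw [Nat.card_congr e.toEquiv, Nat.card_prod, Nat.card_congr Multiplicative.toAdd,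
    Nat.card_congr Multiplicative.toAdd, Nat.card_zmod, Nat.card_zmod]
end

section
/- Let α ∈ k satisfy α^(q²) = α and α^q ≠ α, and let c ∈ k satisfy c^((q+1)/2) = −(α − α^q)². Then there is a k-algebra field automorphism σ_c of F determined by σ_c(x) = ((α + α^q)·x − 2·α^(q+1)) / (2·x − (α + α^q)) and σ_c(y) = c·y / (2·x − (α + α^q))², and σ_c fixes the element u = (x² − α^(q+1)) / (x − (α + α^q)/2). Moreover, for c₀ = (α − α^q)², the automorphism σ_{c₀} is an involution: σ_{c₀} ∘ σ_{c₀} = id. -/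
open IntermediateField Polynomial

theorem irreducible_X_pow_sub_C_of_X_dvd {k : Type*} [Field k] {m : ℕ} (hm : 0 < m) {Q : k[X]}
    (h1 : X ∣ Q) (h2 : ¬ X ^ 2 ∣ Q) : Irreducible (X ^ m - C Q : k[X][X]) := by
  have hmonic : (X ^ m - C Q : k[X][X]).Monic := monic_X_pow_sub_C Q hm.ne'
  have hprime : (Ideal.span {(X : k[X])}).IsPrime :=
    (Ideal.span_singleton_prime X_ne_zero).2 prime_X
  refine irreducible_of_eisenstein_criterion hprime ?_ ?_ ?_ ?_ hmonic.isPrimitive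
  · rw [hmonic.leadingCoeff]
    exact fun h => hprime.ne_top ((Ideal.eq_top_iff_one _).2 h)
  · intro j hj
    rw [degree_X_pow_sub_C hm, Nat.cast_lt] at hj
    rw [Ideal.mem_span_singleton, coeff_sub, coeff_X_pow, if_neg hj.ne, zero_sub, dvd_neg,
      coeff_C]
    split_ifs
    · exact h1
    · exact dvd_zero _
  · rw [degree_X_pow_sub_C hm]
    exact_mod_cast hm
  · rw [Ideal.span_singleton_pow, Ideal.mem_span_singleton, coeff_sub, coeff_X_pow,
      if_neg hm.ne, zero_sub, dvd_neg, coeff_C_zero]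
    exact h2

/-- If `F = k(x, y)` with `x` transcendental and `y ^ m = Q(x)`, where `Y ^ m - Q` is irreducible
over `k(X)`, then `F` is `k(X)[Y] / (Y ^ m - Q)`. -/
theorem exists_algEquiv_adjoinRoot {k F : Type*} [Field k] [Field F] [Algebra k F] {m : ℕ}
    {Q : k[X]}
    (hirr : Irreducible (X ^ m - C (algebraMap k[X] (FractionRing k[X]) Q)))
    {x y : F} (hx : Transcendental k x) (hxy : y ^ m = aeval x Q) (hgen : adjoin k {x, y} = ⊤) :
    ∃ e : AdjoinRoot (X ^ m - C (algebraMap k[X] (FractionRing k[X]) Q)) ≃ₐ[k] F,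
      e (AdjoinRoot.of _ (algebraMap k[X] (FractionRing k[X]) X)) = x ∧
        e (AdjoinRoot.root _) = y := by
  have : Fact (Irreducible (X ^ m - C (algebraMap k[X] (FractionRing k[X]) Q))) := ⟨hirr⟩
  have hinj : Function.Injective (aeval x : k[X] →ₐ[k] F) := transcendental_iff_injective.1 hx
  let f : FractionRing k[X] →ₐ[k] F := IsFractionRing.liftAlgHom hinj
  have hf (r : k[X]) : f (algebraMap k[X] (FractionRing k[X]) r) = aeval x r :=
    IsFractionRing.lift_algebraMap (g := (aeval x : k[X] →ₐ[k] F).toRingHom) hinj r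
  let g := AdjoinRoot.liftAlgHom (X ^ m - C (algebraMap k[X] (FractionRing k[X]) Q)) f y
    (by simp [eval₂_sub, hf, hxy])
  have hgx : g (AdjoinRoot.of _ (algebraMap k[X] (FractionRing k[X]) X)) = x := by
    simp only [g, AdjoinRoot.liftAlgHom_of, hf, aeval_X]
  have hgy : g (AdjoinRoot.root _) = y := AdjoinRoot.liftAlgHom_root _ _ _ _
  have hsurj : Function.Surjective g := by
    rw [← AlgHom.fieldRange_eq_top, eq_top_iff, ← hgen, adjoin_le_iff]
    rintro z (rfl | rfl)
    · exact ⟨_, hgx⟩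
    · exact ⟨_, hgy⟩
  exact ⟨AlgEquiv.ofBijective g ⟨g.toRingHom.injective, hsurj⟩, hgx, hgy⟩

theorem exists_algEquiv_of_pow_eq {k F : Type*} [Field k] [Field F] [Algebra k F] {m : ℕ}
    (hm : 0 < m) {Q : k[X]} (h1 : X ∣ Q) (h2 : ¬ X ^ 2 ∣ Q) {x y x' y' : F}
    (hx : Transcendental k x) (hxy : y ^ m = aeval x Q) (hgen : adjoin k {x, y} = ⊤)
    (hx' : Transcendental k x') (hxy' : y' ^ m = aeval x' Q) (hgen' : adjoin k {x', y'} = ⊤) :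
    ∃ σ : F ≃ₐ[k] F, σ x = x' ∧ σ y = y' := by
  have hirr : Irreducible (X ^ m - C (algebraMap k[X] (FractionRing k[X]) Q)) := by
    have := ((monic_X_pow_sub_C Q hm.ne').irreducible_iff_irreducible_map_fraction_map
      (K := FractionRing k[X])).1 (irreducible_X_pow_sub_C_of_X_dvd hm h1 h2)
    simpa using this
  obtain ⟨e, hex, hey⟩ := exists_algEquiv_adjoinRoot hirr hx hxy hgen
  obtain ⟨e', hex', hey'⟩ := exists_algEquiv_adjoinRoot hirr hx' hxy' hgen'
  refine ⟨e.symm.trans e', ?_, ?_⟩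
  · rw [AlgEquiv.trans_apply, ← hex, e.symm_apply_apply, hex']
  · rw [AlgEquiv.trans_apply, ← hey, e.symm_apply_apply, hey']

theorem not_X_sq_dvd_X_pow_sub_X {k : Type*} [Field k] {q : ℕ} (hq : 2 ≤ q) :
    ¬ (X ^ 2 : k[X]) ∣ X ^ q - X := by
  intro h
  have := X_pow_dvd_iff.1 h 1 (by norm_num)
  rw [coeff_sub, coeff_X_pow, if_neg (by omega), coeff_X_one] at this
  simp at this

/-- Let `α ∈ 𝔽_{q²} \ 𝔽_q` inside `k` and let `c ∈ k` satisfy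
`c^((q+1)/2) = -(α - α^q)²`.  Then there is a `k`-algebra automorphism `σ_c` of `F`
with `σ_c(x) = ((α + α^q)x - 2α^(q+1)) / (2x - (α + α^q))` and
`σ_c(y) = c y / (2x - (α + α^q))²`, fixing `u = (x² - α^(q+1)) / (x - (α + α^q)/2)`.
Moreover, for `c₀ = (α - α^q)²`, the automorphism `σ_{c₀}` is an involution. -/
theorem stmt_4
    (k : Type*) [Field k] [IsAlgClosed k]
    (p : ℕ) [Fact p.Prime] (hp2 : p ≠ 2) [CharP k p]
    (n q : ℕ) (hq : q = p ^ n) (hq5 : 5 ≤ q)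
    (F : Type*) [Field F] [Algebra k F]
    (x y : F) (hx : Transcendental k x)
    (hxy : y ^ ((q + 1) / 2) = x ^ q - x)
    (hgen : adjoin k {x, y} = ⊤)
    (α : k) (hα : α ^ q ^ 2 = α) (hα' : α ^ q ≠ α)
    (c : k) (hc : c ^ ((q + 1) / 2) = -(α - α ^ q) ^ 2)
    (A : F) (hA : A = algebraMap k F α)
    (u : F) (hu : u = (x ^ 2 - A ^ (q + 1)) / (x - (A + A ^ q) / 2)) :
    (∃ σ : F ≃ₐ[k] F,
        σ x = ((A + A ^ q) * x - 2 * A ^ (q + 1)) / (2 * x - (A + A ^ q)) ∧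
        σ y = algebraMap k F c * y / (2 * x - (A + A ^ q)) ^ 2 ∧
        σ u = u) ∧
    (∀ σ : F ≃ₐ[k] F,
        σ x = ((A + A ^ q) * x - 2 * A ^ (q + 1)) / (2 * x - (A + A ^ q)) →
        σ y = algebraMap k F ((α - α ^ q) ^ 2) * y / (2 * x - (A + A ^ q)) ^ 2 →
        ∀ z : F, σ (σ z) = z) := by
  have hqodd : Odd q := by
    rw [hq]; exact ((Fact.out : p.Prime).odd_of_ne_two hp2).pow
  obtain ⟨m, hm⟩ : ∃ m, q + 1 = 2 * m := (hqodd.add_one).two_dvd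
  have hm' : (q + 1) / 2 = m := by omega
  have : CharP F p := charP_of_injective_algebraMap (algebraMap k F).injective p
  have h2 : (2 : F) ≠ 0 := Ring.two_ne_zero (by rwa [ringChar.eq F p])
  have frob_sub (a b : F) : (a - b) ^ q = a ^ q - b ^ q := by
    rw [hq]; exact sub_pow_char_pow a b n
  have frob_add (a b : F) : (a + b) ^ q = a ^ q + b ^ q := by
    rw [hq]; exact add_pow_char_pow a b p n
  have frob_two : (2 : F) ^ q = 2 := by
    rw [← one_add_one_eq_two, frob_add, one_pow]
  set b := α ^ q with hb
  set B := algebraMap k F b with hB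
  have hAB : A ^ q = B := by rw [hA, hB, hb, map_pow]
  have hBA : B ^ q = A := by
    rw [← hAB, ← pow_mul, ← sq, hA, ← map_pow, hα]
  rw [pow_succ A q, hAB] at hu ⊢
  rw [hm'] at hc hxy
  have hne : A - B ≠ 0 := by
    rw [hA, hB, ← map_sub, _root_.map_ne_zero, sub_ne_zero]
    exact fun h => hα' h.symm
  have hxk (r : k) : x ≠ algebraMap k F r := by
    rintro rfl
    exact hx (isAlgebraic_algebraMap r)
  have hd : 2 * x - (A + B) ≠ 0 := by
    intro h
    apply hxk ((α + b) / 2)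
    rw [map_div₀, map_add, map_ofNat, ← hA, ← hB]
    field_simp
    linear_combination h
  have hgen_of {K : IntermediateField k F} (h1 : x ∈ K) (h2 : y ∈ K) : K = ⊤ := by
    rw [eq_top_iff, ← hgen, adjoin_le_iff]
    rintro z (rfl | rfl)
    exacts [h1, h2]
  have hAK (K : IntermediateField k F) : A ∈ K := hA ▸ K.algebraMap_mem α
  have hBK (K : IntermediateField k F) : B ∈ K := K.algebraMap_mem b
  set x' := ((A + B) * x - 2 * (B * A)) / (2 * x - (A + B)) with hx'def
  have hd' : 2 * x' - (A + B) = (A - B) ^ 2 / (2 * x - (A + B)) := by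
    rw [hx'def]; field_simp; ring
  have hd'0 : 2 * x' - (A + B) ≠ 0 := by
    rw [hd']; exact div_ne_zero (pow_ne_zero _ hne) hd
  have hxx' : x = ((A + B) * x' - 2 * (B * A)) / (2 * x' - (A + B)) := by
    have h := div_mul_cancel₀ ((A + B) * x - 2 * (B * A)) hd
    rw [← hx'def] at h
    rw [eq_div_iff hd'0, hd', mul_div_assoc', div_eq_iff hd]
    linear_combination -(A + B) * h
  have hmem (K : IntermediateField k F) (h : x' ∈ K) : x ∈ K := by
    rw [hxx']
    have h2K : (2 : F) ∈ K := ofNat_mem K 2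
    exact K.div_mem (K.sub_mem (K.mul_mem (K.add_mem (hAK K) (hBK K)) h)
      (K.mul_mem h2K (K.mul_mem (hBK K) (hAK K))))
      (K.sub_mem (K.mul_mem h2K h) (K.add_mem (hAK K) (hBK K)))
  refine ⟨?_, ?_⟩
  · set y' := algebraMap k F c * y / (2 * x - (A + B)) ^ 2 with hy'def
    have hc0 : algebraMap k F c ≠ 0 := by
      rw [_root_.map_ne_zero]
      rintro rfl
      rw [zero_pow (by omega), eq_comm, neg_eq_zero, sq_eq_zero_iff, sub_eq_zero] at hc
      exact hα' hc.symm
    have hyy' : y = y' * (2 * x - (A + B)) ^ 2 / algebraMap k F c := by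
      rw [hy'def]; field_simp
    have hcF : algebraMap k F c ^ m = -(A - B) ^ 2 := by
      rw [← map_pow, hc, map_neg, map_pow, map_sub, ← hA]
    have hdq : (2 * x - (A + B)) ^ q = 2 * x ^ q - (A + B) := by
      rw [frob_sub, mul_pow, frob_two, frob_add, hAB, hBA, add_comm B A]
    have hxy' : y' ^ m = x' ^ q - x' := by
      have hdq0 : 2 * x ^ q - (A + B) ≠ 0 := hdq ▸ pow_ne_zero _ hd
      rw [hy'def, hx'def, div_pow, div_pow, mul_pow, hcF, hxy, ← pow_mul, ← hm, pow_succ _ q, hdq,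
        frob_sub, mul_pow, mul_pow, mul_pow, frob_two, frob_add, hAB, hBA,
        add_comm B A, div_sub_div _ _ hdq0 hd]
      congr 1
      ring
    have hx'tr : Transcendental k x' := by
      intro h
      have hx'K : x' ∈ algebraicClosure k F := mem_algebraicClosure_iff.2 h
      exact hx (mem_algebraicClosure_iff.1 (hmem _ hx'K))
    have hgen' : adjoin k {x', y'} = ⊤ := by
      have hx'K : x' ∈ adjoin k {x', y'} := subset_adjoin _ _ (by simp)
      have hy'K : y' ∈ adjoin k {x', y'} := subset_adjoin _ _ (by simp)
      have hxK := hmem _ hx'K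
      refine hgen_of hxK ?_
      rw [hyy']
      generalize adjoin k {x', y'} = K at *
      exact K.div_mem (K.mul_mem hy'K (pow_mem (K.sub_mem (K.mul_mem (ofNat_mem K 2) hxK)
        (K.add_mem (hAK K) (hBK K))) 2)) (K.algebraMap_mem c)
    obtain ⟨σ, hσx, hσy⟩ := exists_algEquiv_of_pow_eq (m := m) (Q := X ^ q - X) (by omega)
      (dvd_sub (dvd_pow_self X (by omega)) dvd_rfl) (not_X_sq_dvd_X_pow_sub_X (by omega))
      hx (by simpa using hxy) hgen hx'tr (by simpa using hxy') hgen'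
    refine ⟨σ, hσx, hσy, ?_⟩
    have hσA : σ A = A := by rw [hA, σ.commutes]
    have hσB : σ B = B := σ.commutes b
    have hu' : u = 2 * (x ^ 2 - B * A) / (2 * x - (A + B)) := by
      rw [hu, show x - (A + B) / 2 = (2 * x - (A + B)) / 2 by field_simp]
      field_simp
    rw [hu']
    simp only [map_div₀, map_mul, map_sub, map_add, map_pow, map_ofNat, hσA, hσB, hσx]
    rw [hd', hx'def]
    field_simp
    ring
  · intro σ hσx hσy
    have hσA : σ A = A := by rw [hA, σ.commutes]
    have hσB : σ B = B := σ.commutes b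
    have h1 : σ (σ x) = x := by
      rw [hσx, hx'def]
      simp only [map_div₀, map_mul, map_sub, map_add, map_ofNat, hσA, hσB, hσx]
      exact hxx'.symm
    have h2 : σ (σ y) = y := by
      rw [hσy]
      simp only [map_div₀, map_mul, map_sub, map_add, map_pow, map_ofNat, hσA, hσB, hσx, hσy,
        hd', ← hA, ← hB]
      field_simp
    intro z
    have hz : z ∈ adjoin k {x, y} := hgen ▸ mem_top
    induction hz using adjoin_induction with
    | mem z hz =>
      rcases hz with rfl | rfl
      exacts [h1, h2]
    | algebraMap r => simp
    | add a b _ _ ha hb => rw [map_add, map_add, ha, hb]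
    | inv a _ ha => rw [map_inv₀, map_inv₀, ha]
    | mul a b _ _ ha hb => rw [map_mul, map_mul, ha, hb]
end

section
/- Let α ∈ k satisfy α^q = α (an element of F_q in k), and set u = y/(x − α) ∈ F. Then F is a finite Galois extension of the intermediate field k⟮u⟯ generated by k and u, and Gal(F/k⟮u⟯) is isomorphic to the dihedral group of order q−1. -/
open IntermediateField Polynomial

/-- A group of order `2 * d` generated by a rotation of order `d` and a reflection inverting it
is dihedral. -/
lemma nonempty_mulEquiv_dihedralGroup {G : Type*} [Group G] {d : ℕ} [NeZero d] (r s : G)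
    (hr : orderOf r = d) (hs : s * s = 1) (hsr : s * r * s = r⁻¹)
    (hmem : s ∉ Subgroup.zpowers r) (hcard : Nat.card G = 2 * d) :
    Nonempty (G ≃* DihedralGroup d) := by
  have hadd (a b : ZMod d) : r ^ (a + b).val = r ^ a.val * r ^ b.val := by
    rw [ZMod.val_add, ← pow_add]
    have h := pow_mod_orderOf r (a.val + b.val)
    rwa [hr] at h
  have hneg (a : ZMod d) : r ^ (-a).val = (r ^ a.val)⁻¹ := by
    rw [eq_inv_iff_mul_eq_one, ← hadd, neg_add_cancel, ZMod.val_zero, pow_zero]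
  have hsinv : s⁻¹ = s := inv_eq_of_mul_eq_one_left hs
  have hconj (a : ZMod d) : r ^ a.val * s = s * r ^ (-a).val := by
    have h : (s * r * s⁻¹) ^ a.val = s * r ^ a.val * s⁻¹ := conj_pow
    rw [hsinv, hsr, inv_pow, ← hneg] at h
    rw [h, ← mul_assoc, ← mul_assoc, hs, one_mul]
  let f : DihedralGroup d →* G := MonoidHom.mk'
    (fun g => match g with
      | .r i => r ^ i.val
      | .sr i => s * r ^ i.val) <| by
    rintro (a | a) (b | b)
    · simp [hadd]
    · simp only [DihedralGroup.r_mul_sr]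
      rw [← mul_assoc, hconj, mul_assoc, ← hadd, neg_add_eq_sub]
    · simp [hadd, mul_assoc]
    · simp only [DihedralGroup.sr_mul_sr]
      rw [mul_assoc s, ← mul_assoc _ s, hconj, ← mul_assoc, ← mul_assoc, hs, one_mul, ← hadd,
        neg_add_eq_sub]
  have hinj : Function.Injective f := by
    rw [injective_iff_map_eq_one]
    rintro (a | a) h
    · have h : r ^ a.val = 1 := h
      have h' := orderOf_dvd_of_pow_eq_one h
      rw [hr] at h'
      have := Nat.eq_zero_of_dvd_of_lt h' (ZMod.val_lt a)
      rw [(ZMod.val_eq_zero a).1 this, DihedralGroup.r_zero]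
    · have h : s * r ^ a.val = 1 := h
      refine absurd ?_ hmem
      rw [eq_inv_of_mul_eq_one_left h]
      exact inv_mem (pow_mem (Subgroup.mem_zpowers r) _)
  have hfin : Finite G := Nat.finite_of_card_ne_zero (by
    rw [hcard]; exact mul_ne_zero two_ne_zero (NeZero.ne d))
  have hbij : Function.Bijective f := hinj.bijective_of_nat_card_le (by
    rw [hcard, DihedralGroup.nat_card])
  exact ⟨(MulEquiv.ofBijective f hbij).symm⟩

section
variable {k : Type*} [Field k]

/-- Eisenstein's criterion at `T - 1` for `T ^ d * Y ^ m - (T ^ (2 * d) - 1)` over `k[T]`. -/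
lemma irreducible_X_pow_mul_Y_pow_sub {d m : ℕ} (hm : m ≠ 0) (hd : ((2 * d : ℕ) : k) ≠ 0) :
    Irreducible (C (X ^ d) * X ^ m - C (X ^ (2 * d) - 1) : k[X][X]) := by
  have hd0 : d ≠ 0 := by rintro rfl; simp at hd
  set f : k[X][X] := C (X ^ d) * X ^ m - C (X ^ (2 * d) - 1) with hf
  have hcoeff (n : ℕ) : f.coeff n =
      (if n = m then X ^ d else 0) - if n = 0 then X ^ (2 * d) - 1 else 0 := by
    rw [hf, coeff_sub, coeff_C_mul_X_pow, coeff_C]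
  have hcm : f.coeff m = X ^ d := by simp [hcoeff, hm]
  have hc0 : f.coeff 0 = -(X ^ (2 * d) - 1) := by simp [hcoeff, hm.symm]
  have hdeg : f.natDegree = m := by
    refine natDegree_eq_of_le_of_coeff_ne_zero ?_ (by rw [hcm]; exact pow_ne_zero _ X_ne_zero)
    refine natDegree_le_iff_coeff_eq_zero.2 fun n hn => ?_
    rw [hcoeff, if_neg hn.ne', if_neg (by lia), sub_zero]
  have hroot : (X - C 1 : k[X]) ∣ X ^ (2 * d) - 1 := by
    rw [dvd_iff_isRoot]; simp
  have hf0 : f ≠ 0 := by rintro h; rw [h] at hdeg; simp at hdeg; exact hm hdeg.symm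
  refine irreducible_of_eisenstein_criterion (P := Ideal.span {(X - C 1 : k[X])})
    ((Ideal.span_singleton_prime (X_sub_C_ne_zero 1)).2 (prime_X_sub_C 1)) ?_ ?_ ?_ ?_ ?_
  · rw [leadingCoeff, hdeg, hcm, Ideal.mem_span_singleton, dvd_iff_isRoot]
    simp
  · intro n hn
    rw [degree_eq_natDegree hf0, hdeg, Nat.cast_lt] at hn
    rw [hcoeff, if_neg hn.ne, zero_sub, Ideal.mem_span_singleton]
    split_ifs
    · exact hroot.neg_right
    · simp
  · rw [← natDegree_pos_iff_degree_pos, hdeg]; lia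
  · rw [hc0, Ideal.span_singleton_pow, Ideal.mem_span_singleton, dvd_neg]
    rintro ⟨h, hh⟩
    have := congrArg (fun g => (derivative g).eval 1) hh
    have h2 : eval 1 (derivative ((X - 1 : k[X]) ^ 2)) = 0 := by
      rw [derivative_pow]; simp
    simp [h2, derivative_X_pow] at this
    apply hd
    simpa using this
  · intro a ha
    rw [C_dvd_iff_dvd_coeff] at ha
    have h1 := ha m
    have h0 := ha 0
    rw [hcm] at h1
    rw [hc0] at h0
    have := dvd_add (h1.mul_right (X ^ d)) h0
    rw [show (X ^ d * X ^ d + -(X ^ (2 * d) - 1) : k[X]) = 1 by ring] at this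
    exact isUnit_of_dvd_one this

/-- The same polynomial, with the roles of the two variables exchanged. -/
lemma irreducible_Y_pow_sub {d m : ℕ} (hm : m ≠ 0) (hd : ((2 * d : ℕ) : k) ≠ 0) :
    Irreducible (X ^ (2 * d) - C (X ^ m) * X ^ d - 1 : k[X][X]) := by
  have h := (MulEquiv.irreducible_iff (Bivariate.swap (R := k))).2
    (irreducible_X_pow_mul_Y_pow_sub hm hd)
  convert (Associated.refl _).neg_right.irreducible h using 1
  simp only [map_sub, map_mul, map_pow, Bivariate.swap_X, Bivariate.swap_Y, map_one]
  ring

variable {F : Type*} [Field F] [Algebra k F]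

open scoped IntermediateField.algebraAdjoinAdjoin in
lemma irreducible_X_pow_sub_gen {d m : ℕ} (hm : m ≠ 0) (hd : ((2 * d : ℕ) : k) ≠ 0) {u : F}
    (hu : Transcendental k u) :
    Irreducible (X ^ (2 * d) - C (AdjoinSimple.gen k u ^ m) * X ^ d - 1 : k⟮u⟯[X]) := by
  have hd0 : d ≠ 0 := by rintro rfl; simp at hd
  have : UniqueFactorizationMonoid (Algebra.adjoin k {u}) := hu.uniqueFactorizationMonoid_adjoin
  let u' : Algebra.adjoin k {u} := ⟨u, Algebra.self_mem_adjoin_singleton k u⟩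
  have h : Irreducible (X ^ (2 * d) - C (u' ^ m) * X ^ d - 1 : (Algebra.adjoin k {u})[X]) := by
    convert (MulEquiv.irreducible_iff (Bivariate.Transcendental.algEquivAdjoin hu)).2 (irreducible_Y_pow_sub hm hd) using 1
    simp only [Bivariate.Transcendental.algEquivAdjoin_apply, coe_mapAlgHom,
      Polynomial.map_sub, Polynomial.map_mul, Polynomial.map_pow, map_X, map_C,
      Polynomial.map_one, RingHom.coe_coe, map_pow, aeval_X, u']
  have hmonic : (X ^ (2 * d) - C (u' ^ m) * X ^ d - 1 : (Algebra.adjoin k {u})[X]).Monic := by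
    rw [sub_sub]
    refine monic_X_pow_sub ?_
    refine (show degree _ ≤ (d : WithBot ℕ) by compute_degree!).trans_lt ?_
    exact_mod_cast (by lia : d < 2 * d)
  have := (hmonic.irreducible_iff_irreducible_map_fraction_map (K := k⟮u⟯)).1 h
  convert this using 1
  simp
  rfl

/-- If `u ^ m = t ^ d - t ^ (-d)`, then `k(u, t) / k(u)` is Galois with dihedral group, generated
by `t ↦ ζ t` and `t ↦ c / t` with `ζ` a primitive `d`-th root of unity and `c ^ d = -1`. -/
lemma isGalois_and_nonempty_mulEquiv_dihedralGroup [IsAlgClosed k] {d m : ℕ} (hm : m ≠ 0)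
    (hd : ((2 * d : ℕ) : k) ≠ 0) {t u : F} (ht : Transcendental k t)
    (htu : u ^ m * t ^ d = t ^ (2 * d) - 1) (hgen : adjoin k {u, t} = ⊤) :
    FiniteDimensional k⟮u⟯ F ∧ IsGalois k⟮u⟯ F ∧
      Nonempty ((F ≃ₐ[k⟮u⟯] F) ≃* DihedralGroup d) := by
  have hd0 : d ≠ 0 := by rintro rfl; simp at hd
  have hdk : (d : k) ≠ 0 := by
    intro h
    apply hd
    rw [Nat.cast_mul, h, mul_zero]
  have : NeZero d := ⟨hd0⟩
  have : NeZero (d : k) := ⟨hdk⟩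
  have ht0 : t ≠ 0 := by rintro rfl; exact ht isAlgebraic_zero
  set P : k⟮u⟯[X] := X ^ (2 * d) - C (AdjoinSimple.gen k u ^ m) * X ^ d - 1 with hP
  have hPt : aeval t P = 0 := by
    simp only [hP, map_sub, map_mul, map_pow, aeval_X, aeval_C, map_one,
      AdjoinSimple.algebraMap_gen, htu]
    ring
  have hPmonic : P.Monic := by
    rw [hP, sub_sub]
    refine monic_X_pow_sub ?_
    refine (show degree _ ≤ (d : WithBot ℕ) by compute_degree!).trans_lt ?_
    exact_mod_cast (by lia : d < 2 * d)
  have hPdeg : P.natDegree = 2 * d := by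
    rw [hP, sub_sub]
    refine natDegree_sub_eq_left_of_natDegree_lt ?_ |>.trans (natDegree_X_pow _)
    rw [natDegree_X_pow]
    refine (show natDegree _ ≤ d by compute_degree!).trans_lt (by lia)
  have htint : IsIntegral k⟮u⟯ t := ⟨P, hPmonic, hPt⟩
  have hu : Transcendental k u := by
    intro hu
    have := isAlgebraic_adjoin_simple hu.isIntegral
    exact ht (htint.isAlgebraic.restrictScalars k)
  have hmin : minpoly k⟮u⟯ t = P :=
    (minpoly.eq_of_irreducible_of_monic (irreducible_X_pow_sub_gen hm hd hu) hPt hPmonic).symm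
  have htop : k⟮u⟯⟮t⟯ = ⊤ := by
    rw [← restrictScalars_eq_top_iff (K := k), adjoin_simple_adjoin_simple, hgen]
  obtain ⟨ζ, hζ⟩ := HasEnoughRootsOfUnity.exists_primitiveRoot k d
  obtain ⟨c, hc⟩ := IsAlgClosed.exists_pow_nat_eq (-1 : k) (Nat.pos_of_ne_zero hd0)
  have hc0 : c ≠ 0 := by rintro rfl; simp [hd0] at hc
  have hζF : IsPrimitiveRoot (algebraMap k F ζ) d :=
    hζ.map_of_injective (algebraMap k F).injective
  have hcF : (algebraMap k F c) ^ d = -1 := by rw [← map_pow, hc]; simp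
  have hcF0 : algebraMap k F c ≠ 0 := by simpa using hc0
  have hs0 : t ^ d ≠ 0 := pow_ne_zero _ ht0
  have hum : u ^ m = t ^ d - (t ^ d)⁻¹ := by
    field_simp
    rw [htu]; ring
  have hfac : P.map (algebraMap k⟮u⟯ F) = (X ^ d - C (t ^ d)) * (X ^ d - C (-(t ^ d)⁻¹)) := by
    have h1 : (C (t ^ d) * C (t ^ d)⁻¹ : F[X]) = 1 := by
      rw [← C_mul, mul_inv_cancel₀ hs0, C_1]
    simp only [hP, Polynomial.map_sub, Polynomial.map_mul, Polynomial.map_pow, map_X, map_C,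
      Polynomial.map_one, map_pow (algebraMap k⟮u⟯ F), AdjoinSimple.algebraMap_gen, hum]
    rw [C_sub, C_neg]
    linear_combination h1
  have hroot2 : (algebraMap k F c / t) ^ d = -(t ^ d)⁻¹ := by
    rw [div_pow, hcF, neg_div, one_div]
  have hsplits : (P.map (algebraMap k⟮u⟯ F)).Splits := by
    rw [hfac]
    exact (X_pow_sub_C_splits_of_isPrimitiveRoot hζF rfl).mul
      (X_pow_sub_C_splits_of_isPrimitiveRoot hζF hroot2)
  have hdF : (d : F) ≠ 0 := by
    rwa [← map_natCast (algebraMap k F), _root_.map_ne_zero]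
  have hss : t ^ d - -(t ^ d)⁻¹ ≠ 0 := by
    intro h
    have h2 : t ^ (2 * d) + 1 = 0 := by
      field_simp at h
      linear_combination h
    refine ht ⟨X ^ (2 * d) + C 1, X_pow_add_C_ne_zero (by lia) 1, ?_⟩
    simpa using h2
  have hsep : P.Separable := by
    rw [← separable_map (algebraMap k⟮u⟯ F), hfac]
    refine (separable_X_pow_sub_C _ hdF hs0).mul
      (separable_X_pow_sub_C _ hdF (neg_ne_zero.2 (inv_ne_zero hs0))) ?_
    refine ⟨C (-(t ^ d - -(t ^ d)⁻¹)⁻¹), C (t ^ d - -(t ^ d)⁻¹)⁻¹, ?_⟩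
    have h1 : (C (t ^ d - -(t ^ d)⁻¹)⁻¹ * (C (t ^ d) - C (-(t ^ d)⁻¹)) : F[X]) = 1 := by
      rw [← C_sub, ← C_mul, inv_mul_cancel₀ hss, C_1]
    rw [C_neg]
    linear_combination h1
  have hsf : P.IsSplittingField k⟮u⟯ F := by
    refine ⟨hsplits, top_le_iff.1 ?_⟩
    rw [← top_toSubalgebra, ← htop,
      adjoin_simple_toSubalgebra_of_isAlgebraic htint.isAlgebraic]
    apply Algebra.adjoin_mono
    rw [Set.singleton_subset_iff, mem_rootSet]
    exact ⟨hPmonic.ne_zero, hPt⟩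
  have hfd : FiniteDimensional k⟮u⟯ F := IsSplittingField.finiteDimensional F P
  have hgal : IsGalois k⟮u⟯ F := IsGalois.of_separable_splitting_field hsep
  refine ⟨hfd, hgal, ?_⟩
  have hcard : Nat.card (F ≃ₐ[k⟮u⟯] F) = 2 * d := by
    rw [IsGalois.card_aut_eq_finrank, ← finrank_top', ← htop, adjoin.finrank htint, hmin, hPdeg]
  have hext {σ τ : F ≃ₐ[k⟮u⟯] F} (h : σ t = τ t) : σ = τ := by
    apply AlgEquiv.coe_toAlgHom_injective
    refine AlgHom.ext_of_adjoin_eq_top (s := {t}) ?_ ?_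
    · rw [← adjoin_simple_toSubalgebra_of_isAlgebraic htint.isAlgebraic, htop, top_toSubalgebra]
    · rintro _ rfl
      exact h
  have haeval (z : F) (hz : z ^ d = t ^ d ∨ z ^ d = -(t ^ d)⁻¹) :
      ∃ σ : F ≃ₐ[k⟮u⟯] F, σ t = z := by
    refine minpoly.exists_algEquiv_of_root' htint.isAlgebraic ?_
    rw [hmin, aeval_def, ← eval_map, hfac]
    rcases hz with hz | hz <;> simp [hz]
  have hk (σ : F ≃ₐ[k⟮u⟯] F) (a : k) : σ (algebraMap k F a) = algebraMap k F a := by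
    rw [IsScalarTower.algebraMap_apply k k⟮u⟯ F, σ.commutes]
  obtain ⟨r, hr⟩ := haeval (algebraMap k F ζ * t) (.inl (by rw [mul_pow, hζF.pow_eq_one, one_mul]))
  obtain ⟨s, hs⟩ := haeval (algebraMap k F c / t) (.inr hroot2)
  have hrpow (i : ℕ) : (r ^ i) t = algebraMap k F ζ ^ i * t := by
    induction i with
    | zero => simp
    | succ i ih => rw [pow_succ', AlgEquiv.mul_apply, ih, map_mul, map_pow, hk, hr]; ring
  refine nonempty_mulEquiv_dihedralGroup r s ?_ ?_ ?_ ?_ hcard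
  · rw [orderOf_eq_iff (Nat.pos_of_ne_zero hd0)]
    refine ⟨hext ?_, fun i hi hi0 h => ?_⟩
    · rw [hrpow, hζF.pow_eq_one, one_mul, AlgEquiv.one_apply]
    · have h' := hrpow i
      rw [h, AlgEquiv.one_apply, eq_comm, mul_eq_right₀ ht0] at h'
      exact hζF.pow_ne_one_of_pos_of_lt hi0.ne' hi h'
  · apply hext
    rw [AlgEquiv.mul_apply, hs, map_div₀, hk, hs, AlgEquiv.one_apply]
    field_simp
  · rw [eq_inv_iff_mul_eq_one]
    apply hext
    have hζ0 : algebraMap k F ζ ≠ 0 := hζF.ne_zero hd0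
    simp only [AlgEquiv.mul_apply, AlgEquiv.one_apply, hs, hr, map_div₀, map_mul, hk]
    field_simp
  · intro hmem
    obtain ⟨i, rfl⟩ := Submonoid.mem_powers_iff _ _ |>.1 (mem_powers_iff_mem_zpowers.2 hmem)
    rw [hrpow, eq_div_iff ht0] at hs
    refine ht ⟨C (ζ ^ i) * X ^ 2 - C c, fun h => ?_, ?_⟩
    · have := congrArg (coeff · 0) h
      simp [hc0] at this
    · simp only [map_sub, map_mul, map_pow, aeval_C, aeval_X]
      linear_combination hs
end

/-- Let `α ∈ 𝔽_q` inside `k` and set `u = y / (x - α) ∈ F`.  Then `F`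
is a finite Galois extension of `k⟮u⟯` and `Gal(F/k⟮u⟯)` is isomorphic to the dihedral
group of order `q - 1` (i.e. `DihedralGroup ((q-1)/2)`). -/
theorem stmt_5
    (k : Type*) [Field k] [IsAlgClosed k]
    (p : ℕ) [Fact p.Prime] (hp2 : p ≠ 2) [CharP k p]
    (n q : ℕ) (hq : q = p ^ n) (hq5 : 5 ≤ q)
    (F : Type*) [Field F] [Algebra k F]
    (x y : F) (hx : Transcendental k x)
    (hxy : y ^ ((q + 1) / 2) = x ^ q - x)
    (hgen : adjoin k {x, y} = ⊤)
    (α : k) (hα : α ^ q = α)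
    (u : F) (hu : u = y / (x - algebraMap k F α)) :
    FiniteDimensional k⟮u⟯ F ∧ IsGalois k⟮u⟯ F ∧
      Nonempty ((F ≃ₐ[k⟮u⟯] F) ≃* DihedralGroup ((q - 1) / 2)) := by
  have hn : n ≠ 0 := by rintro rfl; simp at hq; lia
  have hodd : Odd q := hq ▸ ((Fact.out : p.Prime).odd_of_ne_two hp2).pow
  obtain ⟨d, hd⟩ := hodd
  have hm : (q + 1) / 2 = d + 1 := by lia
  have hd' : (q - 1) / 2 = d := by lia
  rw [hm] at hxy
  rw [hd']
  have hqk : (q : k) = 0 := by rw [hq, Nat.cast_pow, CharP.cast_eq_zero, zero_pow hn]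
  have hdk : ((2 * d : ℕ) : k) ≠ 0 := by
    intro h
    rw [hd, Nat.cast_add, h] at hqk
    simp at hqk
  have : CharP F p := charP_of_injective_algebraMap (algebraMap k F).injective p
  have ht : Transcendental k (x - algebraMap k F α) := by
    intro h
    apply hx
    simpa using h.add (isAlgebraic_algebraMap α)
  set t := x - algebraMap k F α with htdef
  have ht0 : t ≠ 0 := by rintro h; exact ht (h ▸ isAlgebraic_zero)
  have hyu : y = u * t := by rw [hu, div_mul_cancel₀ _ ht0]
  have hxt : x = t + algebraMap k F α := by rw [htdef, sub_add_cancel]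
  refine isGalois_and_nonempty_mulEquiv_dihedralGroup (m := d + 1) (by lia) hdk ht ?_ ?_
  · have h : t ^ q - t = x ^ q - x := by
      rw [htdef, hq, sub_pow_char_pow, ← hq, ← map_pow, hα]
      ring
    rw [← hxy, hyu, hd, mul_pow] at h
    apply mul_right_cancel₀ ht0
    linear_combination -h
  · rw [_root_.eq_top_iff, ← hgen, adjoin_le_iff]
    have hut : u ∈ adjoin k {u, t} := subset_adjoin _ _ (by simp)
    have htt : t ∈ adjoin k {u, t} := subset_adjoin _ _ (by simp)
    rintro z (rfl | rfl)
    · rw [hxt]; exact add_mem htt (_root_.algebraMap_mem _ _)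
    · rw [hyu]; exact mul_mem hut htt
end

section
/- Let a, b ∈ k with a^q = a, b^q = b and a ≠ b, and set u = y/((x − a)(x − b)) ∈ F. Then F is a finite Galois extension of the intermediate field k⟮u⟯ generated by k and u, and Gal(F/k⟮u⟯) is isomorphic to the dihedral group of order q−1. -/
open IntermediateField Polynomial

/-- A rational function `P / Q` in lowest terms has degree at least `deg P` over `k(P / Q)`. -/
theorem RatFunc.natDegree_le_finrank_adjoin_div {k : Type*} [Field k] {P Q : k[X]} (hQ : Q ≠ 0)
    (hPQ : IsCoprime P Q) {f : RatFunc k}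
    (hf : f = algebraMap k[X] (RatFunc k) P / algebraMap k[X] (RatFunc k) Q) :
    P.natDegree ≤ Module.finrank k⟮f⟯ (RatFunc k) := by
  rw [RatFunc.finrank_eq_max_natDegree]
  refine le_max_of_le_left ?_
  rcases eq_or_ne P 0 with rfl | hP
  · simp
  have hf0 : f ≠ 0 := by
    rw [hf]
    exact div_ne_zero (RatFunc.algebraMap_ne_zero hP) (RatFunc.algebraMap_ne_zero hQ)
  refine natDegree_le_of_dvd (hPQ.dvd_of_dvd_mul_right ?_) (RatFunc.num_ne_zero hf0)
  refine ⟨f.denom, RatFunc.algebraMap_injective k ?_⟩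
  have h := RatFunc.num_div_denom f
  rw [hf, div_eq_div_iff (RatFunc.algebraMap_ne_zero (RatFunc.denom_ne_zero _))
    (RatFunc.algebraMap_ne_zero hQ), ← hf] at h
  simpa only [map_mul] using h

theorem Polynomial.rootMultiplicity_pow_eq_mul {k : Type*} [Field k] (P : k[X])
    (z : k) (n : ℕ) : (P ^ n).rootMultiplicity z = n * P.rootMultiplicity z := by
  classical
  rw [← count_roots, ← count_roots, roots_pow, Multiset.count_nsmul]

/-- If a power of `P / Q` is an `m`-th power in `k(X)` and `P` has a simple zero at which `Q` does
not vanish, then the exponent is divisible by `m`. -/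
theorem RatFunc.dvd_of_pow_eq_div_pow {k : Type*} [Field k] {P Q : k[X]} {z : k}
    {m d : ℕ} (hm0 : m ≠ 0) (hP : P.rootMultiplicity z = 1) (hQ : Q.eval z ≠ 0)
    {h : RatFunc k}
    (hm : h ^ m = (algebraMap k[X] (RatFunc k) P / algebraMap k[X] (RatFunc k) Q) ^ d) :
    m ∣ d := by
  have hQ0 : Q ≠ 0 := by rintro rfl; simp at hQ
  have hP0 : P ≠ 0 := by rintro rfl; simp at hP
  have hh : h ≠ 0 := by
    rintro rfl
    rw [zero_pow hm0] at hm
    exact pow_ne_zero d (div_ne_zero (RatFunc.algebraMap_ne_zero hP0)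
      (RatFunc.algebraMap_ne_zero hQ0)) hm.symm
  have hn := RatFunc.num_ne_zero hh
  have hd := RatFunc.denom_ne_zero h
  rw [← RatFunc.num_div_denom h, div_pow, div_pow, div_eq_div_iff
    (pow_ne_zero _ (RatFunc.algebraMap_ne_zero hd))
    (pow_ne_zero _ (RatFunc.algebraMap_ne_zero hQ0))] at hm
  simp only [← map_pow, ← map_mul] at hm
  have := congrArg (fun A => rootMultiplicity z A) (RatFunc.algebraMap_injective k hm)
  rw [rootMultiplicity_mul (by positivity), rootMultiplicity_mul (by positivity),
    rootMultiplicity_pow_eq_mul, rootMultiplicity_pow_eq_mul,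
    rootMultiplicity_pow_eq_mul, rootMultiplicity_pow_eq_mul, hP,
    rootMultiplicity_eq_zero hQ] at this
  refine (Nat.dvd_add_right (Dvd.intro (h.denom.rootMultiplicity z) rfl)).mp
    (Dvd.intro (h.num.rootMultiplicity z) ?_)
  lia

theorem adjoin_simple_eq_top_of_adjoin_pair {k F : Type*} [Field k] [Field F] [Algebra k F]
    {s t : F} (h : adjoin k {s, t} = ⊤) : adjoin k⟮s⟯ {t} = ⊤ := by
  rw [← restrictScalars_eq_top_iff (K := k), adjoin_simple_adjoin_simple, h]

/-- Lower bound for the degree of `k(t, u)` over `k(u)` when `u ^ m = P(t) / Q(t)`. -/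
theorem natDegree_le_finrank_adjoin_of_pow_eq {k F : Type*} [Field k] [Field F] [Algebra k F]
    {t u : F} (ht : Transcendental k t) (htu : adjoin k {t, u} = ⊤) {P Q : k[X]} {z : k}
    (hP : P.rootMultiplicity z = 1) (hQ : Q.eval z ≠ 0) (hPQ : IsCoprime P Q)
    {m : ℕ} (hm : 0 < m) (hu : u ^ m * aeval t Q = aeval t P) :
    P.natDegree ≤ Module.finrank k⟮u⟯ F := by
  have hQ0 : Q ≠ 0 := by rintro rfl; simp at hQ
  have haev : Function.Injective (aeval t : k[X] →ₐ[k] F) :=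
    transcendental_iff_injective.mp ht
  let φ : RatFunc k →ₐ[k] F := RatFunc.liftAlgHom (aeval t : k[X] →ₐ[k] F)
    (nonZeroDivisors_le_comap_nonZeroDivisors_of_injective _ haev)
  have hφ (A : k[X]) : φ (algebraMap k[X] (RatFunc k) A) = aeval t A := by
    simpa using RatFunc.liftAlgHom_apply_div' (aeval t : k[X] →ₐ[k] F)
      (nonZeroDivisors_le_comap_nonZeroDivisors_of_injective _ haev) A 1
  set f : RatFunc k := algebraMap k[X] (RatFunc k) P / algebraMap k[X] (RatFunc k) Q with hf
  have hfu : φ f = u ^ m := by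
    rw [hf, map_div₀, hφ, hφ, div_eq_iff, hu]
    exact (map_ne_zero_iff _ haev).mpr hQ0
  have hE : (⊤ : IntermediateField k (RatFunc k)).map φ = k⟮t⟯ := by
    rw [← RatFunc.adjoin_X, adjoin_map, Set.image_singleton, ← RatFunc.algebraMap_X, hφ, aeval_X]
  have hV : (k⟮f⟯).map φ = k⟮u ^ m⟯ := by
    rw [adjoin_map, Set.image_singleton, hfu]
  have hVE : k⟮u ^ m⟯ ≤ k⟮t⟯ := by
    rw [← hE, ← hV]
    exact IntermediateField.map_mono _ le_top
  have hVU : k⟮u ^ m⟯ ≤ k⟮u⟯ := by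
    rw [adjoin_simple_le_iff]
    exact pow_mem (mem_adjoin_simple_self k u) m
  have hrel : P.natDegree ≤ (k⟮u ^ m⟯).relfinrank k⟮t⟯ := by
    rw [← hE, ← hV, relfinrank_map_map, relfinrank_top_right]
    exact RatFunc.natDegree_le_finrank_adjoin_div hQ0 hPQ hf
  have hgt : u ^ m ∈ k⟮t⟯ := hVE (mem_adjoin_simple_self k _)
  -- the degree over `k(t)`
  have hdvd : m ∣ Module.finrank k⟮t⟯ F := by
    have hnorm : (Algebra.norm k⟮t⟯ u) ^ m =
        (⟨u ^ m, hgt⟩ : k⟮t⟯) ^ Module.finrank k⟮t⟯ F := by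
      rw [← map_pow, ← Algebra.norm_algebraMap]
      rfl
    obtain ⟨h, -, hh⟩ : ((Algebra.norm k⟮t⟯ u : k⟮t⟯) : F) ∈
        (⊤ : IntermediateField k (RatFunc k)).map φ := by
      rw [hE]; exact SetLike.coe_mem _
    have hφi : Function.Injective φ := φ.injective
    refine RatFunc.dvd_of_pow_eq_div_pow (h := h) hm.ne' hP hQ (hφi ?_)
    have h3 := congrArg (fun w : k⟮t⟯ => (w : F)) hnorm
    simp only [SubmonoidClass.coe_pow, ← hfu] at h3
    rw [← hf, map_pow, map_pow, ← h3, ← hh]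
    rfl
  have hpos : 0 < Module.finrank k⟮t⟯ F := by
    have hint : IsIntegral k⟮t⟯ u := by
      refine IsIntegral.of_pow hm ?_
      exact isIntegral_algebraMap (R := k⟮t⟯) (A := F) (x := ⟨u ^ m, hgt⟩)
    have := adjoin.finiteDimensional hint
    rw [adjoin_simple_eq_top_of_adjoin_pair htu] at this
    have : FiniteDimensional k⟮t⟯ F := topEquiv.toLinearEquiv.finiteDimensional
    exact Module.finrank_pos
  have hle : m ≤ Module.finrank k⟮t⟯ F := Nat.le_of_dvd hpos hdvd
  -- the degree of `k(u)` over `k(u ^ m)`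
  have hrelU : (k⟮u ^ m⟯).relfinrank k⟮u⟯ ≤ m := by
    have hroot : aeval u (X ^ m - C (⟨u ^ m, mem_adjoin_simple_self k _⟩ : k⟮u ^ m⟯)) = 0 := by
      simp
    have hmon := monic_X_pow_sub_C (⟨u ^ m, mem_adjoin_simple_self k _⟩ : k⟮u ^ m⟯) hm.ne'
    rw [relfinrank_eq_finrank_of_le hVU, extendScalars_adjoin hVU,
      adjoin.finrank ⟨_, hmon, hroot⟩]
    exact (natDegree_le_of_dvd (minpoly.dvd _ _ hroot) hmon.ne_zero).trans_eq natDegree_X_pow_sub_C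
  have h1 := relfinrank_mul_finrank_top hVE
  rw [← relfinrank_mul_finrank_top hVU] at h1
  have : P.natDegree * m ≤ Module.finrank k⟮u⟯ F * m := by
    calc _ ≤ _ := Nat.mul_le_mul hrel hle
      _ = _ := h1
      _ ≤ _ := by rw [mul_comm]; gcongr
  exact Nat.le_of_mul_le_mul_right this hm

/-- A field generated by a root `t` of `T ^ (2 * r) + w * T ^ r - 1` of maximal degree is Galois
with dihedral group, generated by `t ↦ ζ * t` and `t ↦ ε / t` with `ζ ^ r = 1`, `ε ^ r = -1`. -/
theorem isGalois_dihedralGroup_of_root {k K F : Type*} [Field k] [IsAlgClosed k] [Field K]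
    [Field F] [Algebra k K] [Algebra K F] [Algebra k F] [IsScalarTower k K F] {r : ℕ}
    (hr : (r : k) ≠ 0) {t : F} (ht : Transcendental k t) (htop : K⟮t⟯ = ⊤) {w : K}
    (hw : t ^ (2 * r) + algebraMap K F w * t ^ r - 1 = 0) (hdeg : 2 * r ≤ Module.finrank K F) :
    FiniteDimensional K F ∧ IsGalois K F ∧ Nonempty ((F ≃ₐ[K] F) ≃* DihedralGroup r) := by
  have hr0 : 0 < r := by
    rcases Nat.eq_zero_or_pos r with rfl | h
    · simp at hr
    · exact h
  have : NeZero (r : k) := ⟨hr⟩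
  have : NeZero r := ⟨hr0.ne'⟩
  set P : K[X] := X ^ (2 * r) + (C w * X ^ r - 1) with hP
  have hlt : (C w * X ^ r - 1 : K[X]).degree < (2 * r : ℕ) := by
    refine (degree_sub_le _ _).trans_lt (max_lt ?_ ?_)
    · refine (degree_C_mul_X_pow_le _ _).trans_lt ?_
      exact_mod_cast (by lia : r < 2 * r)
    · rw [degree_one]
      exact_mod_cast (by lia : 0 < 2 * r)
  have hPm : P.Monic := monic_X_pow_add hlt
  have hPd : P.natDegree = 2 * r := by
    rw [hP, natDegree_add_eq_left_of_degree_lt (by rwa [degree_X_pow]), natDegree_X_pow]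
  have hPs (s : F) : aeval s P = s ^ (2 * r) + algebraMap K F w * s ^ r - 1 := by
    simp [hP]; ring
  have hint : IsIntegral K t := ⟨P, hPm, (hPs t).trans hw⟩
  have hfin : FiniteDimensional K F := by
    have := adjoin.finiteDimensional hint
    rw [htop] at this
    exact topEquiv.toLinearEquiv.finiteDimensional
  have hmin : minpoly K t = P := by
    refine (eq_of_monic_of_dvd_of_natDegree_le (minpoly.monic hint) hPm
      (minpoly.dvd _ _ ((hPs t).trans hw)) ?_).symm
    rw [hPd, (Field.primitive_element_iff_minpoly_natDegree_eq K t).mp htop]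
    exact hdeg
  have hrank : Module.finrank K F = 2 * r := by
    rw [← hPd, ← hmin, (Field.primitive_element_iff_minpoly_natDegree_eq K t).mp htop]
  let pb : PowerBasis K F := PowerBasis.ofAdjoinEqTop hint (by
    rw [← adjoin_simple_toSubalgebra_of_isAlgebraic hint.isAlgebraic, htop, top_toSubalgebra])
  have hgen : pb.gen = t := PowerBasis.ofAdjoinEqTop_gen _ _
  have ht0 : t ≠ 0 := by
    rintro rfl
    exact ht isAlgebraic_zero
  -- every root of `P` is the image of `t` under an automorphism
  have hlift (s : F) (hs : aeval s P = 0) : ∃ f : F ≃ₐ[K] F, f t = s := by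
    let g := pb.lift s (by rw [hgen, hmin, hs])
    refine ⟨(algEquivEquivAlgHom K F).symm g, ?_⟩
    have h1 : (algEquivEquivAlgHom K F ((algEquivEquivAlgHom K F).symm g)) t = g t := by simp
    have h2 : g t = s := by
      conv_lhs => rw [← hgen]
      exact pb.lift_gen _ _
    exact h1.trans h2
  have hext {f g : F ≃ₐ[K] F} (h : f t = g t) : f = g := by
    have : (f : F →ₐ[K] F) = g := pb.algHom_ext (by simpa [hgen] using h)
    exact AlgEquiv.coe_toAlgHom_injective this
  -- the roots of unity
  obtain ⟨ζ, hζ⟩ := HasEnoughRootsOfUnity.exists_primitiveRoot k r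
  obtain ⟨ε, hε⟩ := IsAlgClosed.exists_pow_nat_eq (-1 : k) hr0
  have hε0 : ε ≠ 0 := by
    rintro rfl
    simp [hr0.ne'] at hε
  have hζu : IsPrimitiveRoot (hζ.isUnit hr0.ne').unit r := by
    exact IsPrimitiveRoot.coe_units_iff.mp hζ
  let e := hζu.zmodEquivZPowers
  let z (i : ZMod r) : k := (((e i).toMul : Subgroup.zpowers _) : kˣ)
  have hz0 (i) : z i ≠ 0 := Units.ne_zero _
  have hzadd (i j) : z (i + j) = z i * z j := by simp [z]
  have hzinj : Function.Injective z := by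
    intro i j h
    apply e.injective
    apply Additive.toMul.injective
    exact Subtype.ext (Units.ext h)
  have hzr (i) : z i ^ r = 1 := by
    have h1 : ∀ n : ℕ, z i ^ n = z (n * i) := fun n => by
      induction n with
      | zero => simp [z]
      | succ n ih => rw [pow_succ, ih, ← hzadd]; push_cast; ring_nf
    rw [h1]
    simp [z]
  let c := algebraMap k F
  have hc0 {a : k} (ha : a ≠ 0) : c a ≠ 0 := by simpa [c] using ha
  have hcK (f : F ≃ₐ[K] F) (a : k) : f (c a) = c a := by
    simp only [c, IsScalarTower.algebraMap_apply k K F, AlgEquiv.commutes]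
  have hrot (i) : ∃ f : F ≃ₐ[K] F, f t = c (z i) * t := by
    apply hlift
    have h1 : c (z i) ^ r = 1 := by rw [← map_pow, hzr, map_one]
    rw [hPs, mul_pow, mul_pow, mul_comm 2 r, pow_mul (c (z i)), h1, ← hw]
    ring
  have hrefl (i) : ∃ f : F ≃ₐ[K] F, f t = c (ε * z i) / t := by
    apply hlift
    have h1 : c (ε * z i) ^ r = -1 := by rw [← map_pow, mul_pow, hzr, hε]; simp
    have h2 : t ^ r ≠ 0 := pow_ne_zero _ ht0
    rw [hPs, div_pow, div_pow, mul_comm 2 r, pow_mul (c _), h1, pow_mul]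
    rw [mul_comm 2 r, pow_mul] at hw
    field_simp
    linear_combination -hw
  choose ρ hρ using hrot
  choose τ hτ using hrefl
  let Φ : DihedralGroup r →* (F ≃ₐ[K] F) := MonoidHom.mk'
    (fun g => match g with
      | .r i => ρ i
      | .sr i => τ i) (by
    have hsub (i j) : z (j - i) * z i = z j := by rw [← hzadd, sub_add_cancel]
    rintro (i | i) (j | j) <;> apply hext
    · simp [hρ, hcK, hzadd]; ring
    · have := hc0 (hz0 i)
      simp [hρ, hτ, hcK, ← hsub i j]; field_simp
    · simp [hρ, hτ, hcK, hzadd]; field_simp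
    · have := hc0 (hz0 i)
      have := hc0 hε0
      simp [hρ, hτ, hcK, ← hsub i j]; field_simp)
  have hΦr (i) : Φ (.r i) t = c (z i) * t := hρ i
  have hΦs (i) : Φ (.sr i) t = c (ε * z i) / t := hτ i
  have hne (i j) : Φ (.r i) ≠ Φ (.sr j) := by
    intro h
    have h1 := congrArg (fun f : F ≃ₐ[K] F => f t) h
    simp only [hΦr, hΦs] at h1
    rw [eq_div_iff ht0] at h1
    refine ht ⟨C (z i) * X ^ 2 - C (ε * z j), ?_, ?_⟩
    · intro h0
      have := congrArg (fun A => coeff A 2) h0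
      simp [hz0] at this
    · simp only [map_sub, map_mul, aeval_C, map_pow, aeval_X]
      simp only [c, map_mul] at h1
      linear_combination h1
  have hinj : Function.Injective Φ := by
    rintro (i | i) (j | j) h
    · have h1 := congrArg (fun f : F ≃ₐ[K] F => f t) h
      simp only [hΦr] at h1
      rw [hzinj (c.injective (mul_right_cancel₀ ht0 h1))]
    · exact absurd h (hne _ _)
    · exact absurd h.symm (hne _ _)
    · have h1 := congrArg (fun f : F ≃ₐ[K] F => f t) h
      simp only [hΦs] at h1
      rw [div_left_inj' ht0] at h1
      rw [hzinj (mul_left_cancel₀ hε0 (c.injective h1))]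
  have hcard : Nat.card (F ≃ₐ[K] F) = 2 * r := by
    refine le_antisymm ?_ ?_
    · rw [Nat.card_eq_fintype_card, ← hrank]
      exact AlgEquiv.card_le
    · rw [← DihedralGroup.nat_card]
      exact Nat.card_le_card_of_injective Φ hinj
  refine ⟨hfin, IsGalois.of_card_aut_eq_finrank K F (hcard.trans hrank.symm), ⟨?_⟩⟩
  refine (MulEquiv.ofBijective Φ ((Nat.bijective_iff_injective_and_card _).mpr ⟨hinj, ?_⟩)).symm
  rw [hcard, DihedralGroup.nat_card]

theorem Polynomial.rootMultiplicity_one_sub_X_pow {k : Type*} [Field k] {n : ℕ} (hn : (n : k) ≠ 0) :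
    (1 - X ^ n : k[X]).rootMultiplicity 1 = 1 := by
  have h0 : (1 - X ^ n : k[X]) ≠ 0 := by
    intro h
    have := congrArg (fun A => eval 1 (derivative A)) h
    simp [derivative_X_pow, hn] at this
  refine le_antisymm ?_ ((rootMultiplicity_pos h0).mpr (by simp))
  by_contra! h
  have := ((one_lt_rootMultiplicity_iff_isRoot h0).mp h).2
  simp [derivative_X_pow, hn] at this

/-- If `c * u ^ m = (1 - t ^ (2 * r)) / t ^ r` with `t` transcendental and `F = k(t, u)`, then
`F / k(u)` is Galois with dihedral group of order `2 * r`. -/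
theorem isGalois_adjoin_dihedralGroup {k F : Type*} [Field k] [IsAlgClosed k] [Field F]
    [Algebra k F] {t u : F} (ht : Transcendental k t) (htu : adjoin k {t, u} = ⊤) {c : k}
    (hc : c ≠ 0) {m r : ℕ} (hm : 0 < m) (hr : ((2 * r : ℕ) : k) ≠ 0)
    (h : u ^ m * (algebraMap k F c * t ^ r) = 1 - t ^ (2 * r)) :
    FiniteDimensional k⟮u⟯ F ∧ IsGalois k⟮u⟯ F ∧
      Nonempty ((F ≃ₐ[k⟮u⟯] F) ≃* DihedralGroup r) := by
  have hdeg : (1 - X ^ (2 * r) : k[X]).natDegree = 2 * r := by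
    rw [← natDegree_neg, neg_sub]
    exact natDegree_X_pow_sub_C (r := (1 : k))
  refine isGalois_dihedralGroup_of_root (k := k)
    (w := ⟨u, mem_adjoin_simple_self k u⟩ ^ m * algebraMap k k⟮u⟯ c) ?_ ht
    (adjoin_simple_eq_top_of_adjoin_pair (by rwa [Set.pair_comm])) ?_ ?_
  · intro h0
    simp [h0] at hr
  · have h1 : algebraMap k⟮u⟯ F (⟨u, mem_adjoin_simple_self k u⟩ ^ m * algebraMap k k⟮u⟯ c) =
        u ^ m * algebraMap k F c := rfl
    rw [h1]
    linear_combination h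
  · rw [← hdeg]
    refine natDegree_le_finrank_adjoin_of_pow_eq (Q := C c * X ^ r) (z := 1) ht htu
      (rootMultiplicity_one_sub_X_pow hr) (by simpa using hc) ⟨1, C c⁻¹ * X ^ r, ?_⟩ hm (by simpa)
    have : (C c⁻¹ * C c : k[X]) = 1 := by rw [← C_mul, inv_mul_cancel₀ hc, C_1]
    linear_combination (X ^ r) ^ 2 * this

/-- Let `a, b ∈ 𝔽_q` inside `k` with `a ≠ b`, and set
`u = y / ((x - a)(x - b)) ∈ F`.  Then `F` is a finite Galois extension of `k⟮u⟯` and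
`Gal(F/k⟮u⟯)` is isomorphic to the dihedral group of order `q - 1`. -/
theorem stmt_6
    (k : Type*) [Field k] [IsAlgClosed k]
    (p : ℕ) [Fact p.Prime] (hp2 : p ≠ 2) [CharP k p]
    (n q : ℕ) (hq : q = p ^ n) (hq5 : 5 ≤ q)
    (F : Type*) [Field F] [Algebra k F]
    (x y : F) (hx : Transcendental k x)
    (hxy : y ^ ((q + 1) / 2) = x ^ q - x)
    (hgen : adjoin k {x, y} = ⊤)
    (a b : k) (ha : a ^ q = a) (hb : b ^ q = b) (hab : a ≠ b)
    (u : F) (hu : u = y / ((x - algebraMap k F a) * (x - algebraMap k F b))) :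
    FiniteDimensional k⟮u⟯ F ∧ IsGalois k⟮u⟯ F ∧
      Nonempty ((F ≃ₐ[k⟮u⟯] F) ≃* DihedralGroup ((q - 1) / 2)) := by
  have : CharP F p := charP_of_injective_algebraMap (algebraMap k F).injective p
  have hodd : Odd q := hq ▸ ((Fact.out : p.Prime).odd_of_ne_two hp2).pow
  obtain ⟨r, hr⟩ := hodd
  have hm : (q + 1) / 2 = r + 1 := by lia
  have hr' : (q - 1) / 2 = r := by lia
  rw [hm] at hxy
  rw [hr']
  have hn : n ≠ 0 := by
    rintro rfl
    simp at hq
    lia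
  have h2r : ((2 * r : ℕ) : k) ≠ 0 := by
    have h : ((2 * r + 1 : ℕ) : k) = 0 := by
      rw [← hr, hq, Nat.cast_pow, CharP.cast_eq_zero, zero_pow hn]
    intro h0
    rw [Nat.cast_add, h0] at h
    simp at h
  have hne (d : k) : x - algebraMap k F d ≠ 0 := by
    intro h
    exact hx (sub_eq_zero.mp h ▸ isAlgebraic_algebraMap d)
  have hpow {d : k} (hd : d ^ q = d) :
      y ^ (r + 1) = (x - algebraMap k F d) ^ q - (x - algebraMap k F d) := by
    have h : (x - algebraMap k F d) ^ q = x ^ q - algebraMap k F d ^ q := by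
      rw [hq, sub_pow_char_pow]
    rw [hxy, h, ← map_pow, hd]
    ring
  have hA := hpow ha
  have hB := hpow hb
  have hA0 := hne a
  have hB0 := hne b
  have hAB : (x - algebraMap k F a) - (x - algebraMap k F b) = algebraMap k F (b - a) := by
    rw [map_sub]; ring
  have hc : algebraMap k F (b - a) ≠ 0 := by
    simpa [sub_eq_zero] using hab.symm
  set A := x - algebraMap k F a with hAdef
  set B := x - algebraMap k F b with hBdef
  set c := algebraMap k F (b - a) with hcdef
  set t := A / B with htdef
  have ht1 : t - 1 = c / B := by
    rw [htdef, ← hAB]; field_simp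
  have hx_eq : x = c / (t - 1) + algebraMap k F b := by
    rw [ht1, div_div_cancel₀ hc, hBdef]; ring
  have ht : Transcendental k t := by
    intro halg
    refine hx ?_
    rw [hx_eq, div_eq_mul_inv]
    exact ((isAlgebraic_algebraMap _).mul (halg.sub isAlgebraic_one).inv).add
      (isAlgebraic_algebraMap _)
  have htu : adjoin k {t, u} = ⊤ := by
    rw [eq_top_iff, ← hgen, adjoin_le_iff]
    have htm : t ∈ adjoin k {t, u} := subset_adjoin _ _ (by simp)
    have hum : u ∈ adjoin k {t, u} := subset_adjoin _ _ (by simp)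
    have hxm : x ∈ adjoin k {t, u} := by
      rw [hx_eq]
      exact add_mem (div_mem (IntermediateField.algebraMap_mem _ _) (sub_mem htm (one_mem _)))
        (IntermediateField.algebraMap_mem _ _)
    refine Set.insert_subset hxm (Set.singleton_subset_iff.mpr ?_)
    have hy : y = u * (A * B) := by rw [hu]; field_simp
    rw [SetLike.mem_coe, hy]
    exact mul_mem hum (mul_mem (sub_mem hxm (IntermediateField.algebraMap_mem _ _))
      (sub_mem hxm (IntermediateField.algebraMap_mem _ _)))
  refine isGalois_adjoin_dihedralGroup ht htu (sub_ne_zero.mpr hab.symm) r.succ_pos h2r ?_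
  have key : y ^ (r + 1) * c = A * B * (B ^ (2 * r) - A ^ (2 * r)) := by
    rw [hr] at hA hB
    rw [← hAB]
    linear_combination A * hB - B * hA
  have hABr : (A * B) ^ (r + 1) ≠ 0 := pow_ne_zero _ (mul_ne_zero hA0 hB0)
  have hBr : B ^ r ≠ 0 := pow_ne_zero _ hB0
  rw [← hcdef, hu, htdef, div_pow, div_pow, div_pow, div_mul_eq_mul_div, div_eq_iff hABr]
  have h1 : y ^ (r + 1) * (c * (A ^ r / B ^ r)) = (y ^ (r + 1) * c) * (A ^ r / B ^ r) := by ring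
  rw [h1, key]
  clear_value A B
  field_simp
  ring
end

section
/- F is a finite Galois extension of the intermediate field k⟮y⟯ generated by k and y, of degree q, and Gal(F/k⟮y⟯) is isomorphic to the additive group of the finite field with q elements (an elementary abelian p-group of order q = p^n). -/
open IntermediateField Polynomial

theorem relfinrank_adjoin_aeval_of_transcendental {k F : Type*} [Field k] [Field F] [Algebra k F]
    {t : F} (ht : Transcendental k t) (g : k[X]) :
    relfinrank k⟮aeval t g⟯ k⟮t⟯ = g.natDegree := by
  let φ : RatFunc k →ₐ[k] F := k⟮t⟯.val.comp (RatFunc.algEquivOfTranscendental t ht).toAlgHom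
  have hφ (h : k[X]) : φ (algebraMap k[X] (RatFunc k) h) = aeval t h := by
    simp [φ]
  have hX : φ RatFunc.X = t := by
    rw [← RatFunc.algebraMap_X, hφ, aeval_X]
  have hg : k⟮aeval t g⟯ = k⟮algebraMap k[X] (RatFunc k) g⟯.map φ := by
    rw [adjoin_map, Set.image_singleton, hφ]
  have ht' : k⟮t⟯ = k⟮(RatFunc.X : RatFunc k)⟯.map φ := by
    rw [adjoin_map, Set.image_singleton, hX]
  rw [hg, ht', relfinrank_map_map, RatFunc.adjoin_X, relfinrank_top_right,
    RatFunc.finrank_eq_max_natDegree]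
  simp

theorem natDegree_dvd_finrank_of_aeval_eq {k F : Type*} [Field k] [Field F] [Algebra k F]
    {x y : F} (hx : Transcendental k x) {f g : k[X]} (hfg : aeval y f = aeval x g)
    (hg : g.natDegree ≠ 0) (hcop : g.natDegree.Coprime f.natDegree) :
    g.natDegree ∣ Module.finrank k⟮y⟯ F := by
  have hg0 : g ≠ 0 := fun h ↦ hg (h ▸ natDegree_zero)
  have hxg : Transcendental k (aeval x g) :=
    hx.aeval g hg (mem_nonZeroDivisors_of_ne_zero (leadingCoeff_ne_zero.mpr hg0))
  have hy : Transcendental k y := fun h ↦ by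
    refine hxg (hfg ▸ isAlgebraic_iff_isIntegral.mpr ?_)
    exact adjoin_le_integralClosure (isAlgebraic_iff_isIntegral.mp h)
      (aeval_mem_adjoin_singleton k y)
  have hle (z : F) (h : k[X]) : k⟮aeval z h⟯ ≤ k⟮z⟯ :=
    adjoin_simple_le_iff.mpr (algebra_adjoin_le_adjoin k {z} (aeval_mem_adjoin_singleton k z))
  have h := relfinrank_mul_finrank_top (hle x g)
  rw [relfinrank_adjoin_aeval_of_transcendental hx, ← hfg,
    ← relfinrank_mul_finrank_top (hle y f), relfinrank_adjoin_aeval_of_transcendental hy] at h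
  exact hcop.dvd_of_dvd_mul_left ⟨_, h.symm⟩

theorem FiniteField.mem_range_of_pow_card_eq {E F : Type*} [Field E] [Finite E] [Field F]
    (j : E →+* F) {z : F} (hz : z ^ Nat.card E = z) : z ∈ j.range := by
  have hs := Polynomial.splits_X_pow_nat_card_sub_X (K := E)
  have hne : (X ^ Nat.card E - X : E[X]) ≠ 0 :=
    FiniteField.X_pow_card_sub_X_ne_zero E Finite.one_lt_card
  have hr : z ∈ ((X ^ Nat.card E - X : E[X]).map j).roots := by
    rw [mem_roots (Polynomial.map_ne_zero hne)]
    simp [hz]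
  rw [hs.roots_map, Multiset.mem_map] at hr
  obtain ⟨e, -, he⟩ := hr
  exact ⟨e, he⟩

theorem separable_X_pow_sub_X_sub_C {K : Type*} [Field K] {p n : ℕ} [CharP K p]
    (hn : n ≠ 0) (a : K) : (X ^ p ^ n - X - C a : K[X]).Separable := by
  have hd : derivative (X ^ p ^ n - X - C a : K[X]) = -1 := by
    simp [derivative_X_pow, hn]
  rw [separable_def, hd]
  exact isCoprime_one_right.neg_right

section ArtinSchreier

variable {E K F : Type*} [Field E] [Finite E] [Field K] [Field F] [Algebra K F]
  {p n : ℕ} [Fact p.Prime] [CharP F p] {x : F} {a : K}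

theorem isSplittingField_X_pow_card_sub_X_sub_C (j : E →+* K) (hE : Nat.card E = p ^ n)
    (hxa : x ^ p ^ n - x = algebraMap K F a) (htop : K⟮x⟯ = ⊤) :
    (X ^ p ^ n - X - C a : K[X]).IsSplittingField K F := by
  have : CharP K p := (algebraMap K F).charP_iff_charP p |>.mpr inferInstance
  have hn : n ≠ 0 := by
    rintro rfl
    exact Finite.one_lt_card.ne' (by simpa using hE)
  refine isSplittingField_iff_intermediateField.mpr ⟨?_, ?_⟩
  · have hcomp : (X ^ p ^ n - X - C a : K[X]).map (algebraMap K F) =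
        ((X ^ Nat.card E - X : E[X]).map ((algebraMap K F).comp j)).comp (X - C x) := by
      simp only [hE, Polynomial.map_sub, Polynomial.map_pow, map_X, map_C, sub_comp, pow_comp,
        X_comp, ← hxa, sub_pow_char_pow, C_sub, C_pow]
      ring
    rw [hcomp]
    exact (splits_X_pow_nat_card_sub_X.map _).comp_X_sub_C x
  · rw [eq_top_iff, ← htop]
    refine adjoin.mono _ _ _ (Set.singleton_subset_iff.mpr ?_)
    rw [mem_rootSet]
    exact ⟨(separable_X_pow_sub_X_sub_C hn a).ne_zero, by simp [hxa]⟩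

theorem isGalois_of_pow_card_sub_eq (j : E →+* K) (hE : Nat.card E = p ^ n)
    (hxa : x ^ p ^ n - x = algebraMap K F a) (htop : K⟮x⟯ = ⊤) :
    IsGalois K F := by
  have := isSplittingField_X_pow_card_sub_X_sub_C j hE hxa htop
  have : CharP K p := (algebraMap K F).charP_iff_charP p |>.mpr inferInstance
  have hn : n ≠ 0 := by
    rintro rfl
    exact Finite.one_lt_card.ne' (by simpa using hE)
  exact IsGalois.of_separable_splitting_field (separable_X_pow_sub_X_sub_C hn a)

theorem exists_monoidHom_injective_of_pow_card_sub_eq (j : E →+* K) (hE : Nat.card E = p ^ n)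
    (hxa : x ^ p ^ n - x = algebraMap K F a) (htop : K⟮x⟯ = ⊤) :
    ∃ f : (F ≃ₐ[K] F) →* Multiplicative E, Function.Injective f := by
  have hmem (σ : F ≃ₐ[K] F) : ∃ e : E, algebraMap K F (j e) = σ x - x := by
    refine FiniteField.mem_range_of_pow_card_eq ((algebraMap K F).comp j) ?_
    have hσ : σ x ^ p ^ n - σ x = x ^ p ^ n - x := by
      rw [← map_pow, ← map_sub, hxa, AlgEquiv.commutes]
    rw [hE, sub_pow_char_pow]
    linear_combination hσ
  choose e he using hmem
  refine ⟨MonoidHom.mk' (fun σ ↦ Multiplicative.ofAdd (e σ)) fun σ τ ↦ ?_, fun σ τ h ↦ ?_⟩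
  · rw [← ofAdd_add]
    refine congrArg _ (((algebraMap K F).comp j).injective ?_)
    have h := congrArg σ (he τ)
    rw [AlgEquiv.commutes, map_sub] at h
    simp only [RingHom.comp_apply, map_add, he, AlgEquiv.mul_apply] at h ⊢
    linear_combination -h
  · have h' : e σ = e τ := h
    have hx : σ x = τ x := sub_left_injective ((he σ).symm.trans (h' ▸ he τ))
    refine AlgEquiv.ext fun z ↦ ?_
    have hz : z ∈ K⟮x⟯ := htop ▸ mem_top
    induction hz using adjoin_induction with
    | mem z hz => rw [Set.mem_singleton_iff.mp hz, hx]
    | algebraMap a => simp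
    | add _ _ _ _ h₁ h₂ => simp [h₁, h₂]
    | inv _ _ h => simp [h]
    | mul _ _ _ _ h₁ h₂ => simp [h₁, h₂]

end ArtinSchreier

/-- `F` is a finite Galois extension of `k⟮y⟯` of degree `q`, and
`Gal(F/k⟮y⟯)` is isomorphic to the additive group of the finite field with `q = p ^ n`
elements. -/
theorem stmt_8
    (k : Type*) [Field k] [IsAlgClosed k]
    (p : ℕ) [Fact p.Prime] (hp2 : p ≠ 2) [CharP k p]
    (n q : ℕ) (hq : q = p ^ n) (hq5 : 5 ≤ q)
    (F : Type*) [Field F] [Algebra k F]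
    (x y : F) (hx : Transcendental k x)
    (hxy : y ^ ((q + 1) / 2) = x ^ q - x)
    (hgen : adjoin k {x, y} = ⊤) :
    FiniteDimensional k⟮y⟯ F ∧ IsGalois k⟮y⟯ F ∧
      Module.finrank k⟮y⟯ F = q ∧
      Nonempty ((F ≃ₐ[k⟮y⟯] F) ≃* Multiplicative (GaloisField p n)) := by
  have hn : n ≠ 0 := by
    rintro rfl
    simp [hq] at hq5
  have : CharP F p := (algebraMap k F).charP_iff_charP p |>.mp inferInstance
  let _ : Algebra (ZMod p) k := ZMod.algebra k p
  let j : GaloisField p n →+* k⟮y⟯ :=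
    (algebraMap k k⟮y⟯).comp (IsAlgClosed.lift : GaloisField p n →ₐ[ZMod p] k).toRingHom
  have hE := GaloisField.card p n hn
  have hxa : x ^ p ^ n - x = algebraMap k⟮y⟯ F (AdjoinSimple.gen k y ^ ((q + 1) / 2)) := by
    rw [map_pow, AdjoinSimple.algebraMap_gen, hxy, hq]
  have htop : k⟮y⟯⟮x⟯ = ⊤ := by
    rw [← restrictScalars_eq_top_iff (K := k), adjoin_simple_adjoin_simple, ← hgen,
      Set.pair_comm]
  have hfd : FiniteDimensional k⟮y⟯ F :=
    have := isSplittingField_X_pow_card_sub_X_sub_C j hE hxa htop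
    IsSplittingField.finiteDimensional F (X ^ p ^ n - X - C (AdjoinSimple.gen k y ^ ((q + 1) / 2)))
  have hgal : IsGalois k⟮y⟯ F := isGalois_of_pow_card_sub_eq j hE hxa htop
  obtain ⟨f, hf⟩ := exists_monoidHom_injective_of_pow_card_sub_eq j hE hxa htop
  have hcard : Nat.card (F ≃ₐ[k⟮y⟯] F) = Module.finrank k⟮y⟯ F := IsGalois.card_aut_eq_finrank _ _
  have hmul : Nat.card (Multiplicative (GaloisField p n)) = q := by
    rw [Nat.card_congr Multiplicative.toAdd, hE, hq]
  have hle : Module.finrank k⟮y⟯ F ≤ q := by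
    rw [← hcard, ← hmul]
    exact Nat.card_le_card_of_injective f hf
  have hodd : Odd q := hq ▸ ((Fact.out : p.Prime).odd_of_ne_two hp2).pow
  have hcop : q.Coprime ((q + 1) / 2) := by
    obtain ⟨r, rfl⟩ := hodd
    rw [show (2 * r + 1 + 1) / 2 = r + 1 by omega, show 2 * r + 1 = r + (r + 1) by omega]
    simp
  have hdvd : q ∣ Module.finrank k⟮y⟯ F := by
    have hg := FiniteField.X_pow_card_sub_X_natDegree_eq k (show 1 < q by omega)
    have h := natDegree_dvd_finrank_of_aeval_eq hx (f := X ^ ((q + 1) / 2)) (g := X ^ q - X)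
      (by simpa using hxy) (by rw [hg]; omega) (by rwa [hg, natDegree_X_pow])
    rwa [hg] at h
  have hfin : Module.finrank k⟮y⟯ F = q :=
    hle.antisymm (Nat.le_of_dvd Module.finrank_pos hdvd)
  refine ⟨hfd, hgal, hfin, ⟨MulEquiv.ofBijective f ?_⟩⟩
  exact (Nat.bijective_iff_injective_and_card f).mpr ⟨hf, by rw [hcard, hfin, hmul]⟩
end

section
/- Let α ∈ k satisfy α^(q²) = α and α^q ≠ α, and set u = (x² − (α^q + α)·x + α^(q+1)) / y ∈ F. Then F is a finite Galois extension of the intermediate field k⟮u⟯ generated by k and u, and Gal(F/k⟮u⟯) is isomorphic to the dihedral group of order q+1. -/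
open IntermediateField Polynomial

theorem degree_C_mul_X_pow_add_one_lt {R : Type*} [CommRing R] {m : ℕ} (hm : 0 < m) (a : R) :
    (C a * X ^ m + 1 : R[X]).degree < (2 * m : ℕ) := by
  refine lt_of_le_of_lt (b := (m : WithBot ℕ)) ?_ ?_
  · compute_degree!
  · exact_mod_cast (by omega : m < 2 * m)

theorem monic_X_pow_two_mul_sub {R : Type*} [CommRing R] {m : ℕ} (hm : 0 < m) (a : R) :
    (X ^ (2 * m) - C a * X ^ m - 1 : R[X]).Monic := by
  rw [sub_sub]
  exact monic_X_pow_sub (degree_C_mul_X_pow_add_one_lt hm a)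

theorem natDegree_X_pow_two_mul_sub {R : Type*} [CommRing R] [Nontrivial R] {m : ℕ} (hm : 0 < m)
    (a : R) : (X ^ (2 * m) - C a * X ^ m - 1 : R[X]).natDegree = 2 * m := by
  have h := degree_C_mul_X_pow_add_one_lt hm a
  rw [← degree_X_pow (R := R) (2 * m)] at h
  rw [sub_sub, natDegree_eq_of_degree_eq (degree_sub_eq_left_of_degree_lt h), natDegree_X_pow]

theorem irreducible_X_pow_two_mul_sub_bivariate {k : Type*} [Field k] {m : ℕ}
    (hm : ((2 * m : ℕ) : k) ≠ 0) :
    Irreducible (X ^ (2 * m) - C (X ^ m) * X ^ m - 1 : k[X][X]) := by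
  have hm0 : 0 < m := Nat.pos_of_ne_zero (by rintro rfl; simp at hm)
  have key : Irreducible (C (X ^ m) * X ^ m + C (1 - X ^ (2 * m)) : k[X][X]) := by
    have hcoeff (i : ℕ) : (C (X ^ m) * X ^ m + C (1 - X ^ (2 * m)) : k[X][X]).coeff i =
        (if i = m then X ^ m else 0) + if i = 0 then 1 - X ^ (2 * m) else 0 := by
      rw [coeff_add, coeff_C_mul_X_pow, coeff_C]
    have hdeg : (C (X ^ m) * X ^ m + C (1 - X ^ (2 * m)) : k[X][X]).natDegree = m := by
      rw [natDegree_add_C, natDegree_C_mul_X_pow _ _ (pow_ne_zero _ X_ne_zero)]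
    have hlead : (C (X ^ m) * X ^ m + C (1 - X ^ (2 * m)) : k[X][X]).leadingCoeff = X ^ m := by
      rw [leadingCoeff, hdeg, hcoeff]
      simp [hm0.ne']
    refine irreducible_of_eisenstein_criterion (P := Ideal.span {X - C 1})
      ((Ideal.span_singleton_prime (X_sub_C_ne_zero 1)).2 (prime_X_sub_C 1)) ?_ ?_ ?_ ?_ ?_
    · rw [hlead, Ideal.mem_span_singleton, dvd_iff_isRoot]
      simp
    · intro i hi
      rw [degree_eq_natDegree (by rw [← leadingCoeff_ne_zero, hlead]; simp), hdeg,
        Nat.cast_lt] at hi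
      rw [Ideal.mem_span_singleton, dvd_iff_isRoot, hcoeff, if_neg hi.ne]
      split_ifs <;> simp
    · rwa [← natDegree_pos_iff_degree_pos, hdeg]
    · rw [Ideal.span_singleton_pow, Ideal.mem_span_singleton, hcoeff, if_neg hm0.ne, if_pos rfl,
        zero_add, ← dvd_neg, neg_sub, sq]
      exact fun h ↦ not_isUnit_X_sub_C 1 ((X_pow_sub_one_separable_iff.2 hm).squarefree _ h)
    · intro r hr
      rw [C_dvd_iff_dvd_coeff] at hr
      have h0 := hr 0
      have h1 := hr m
      simp only [hcoeff, hm0.ne, hm0.ne', if_true, if_false, zero_add, add_zero] at h0 h1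
      refine isUnit_of_dvd_one ?_
      convert dvd_add h0 (Dvd.dvd.mul_left h1 (X ^ m)) using 1
      ring
  rw [← MulEquiv.irreducible_iff (Bivariate.swap (R := k))]
  have h := (Associated.irreducible_iff (Associated.neg_left (Associated.refl _))).2 key
  convert h using 1
  simp [Bivariate.swap_apply]
  ring

theorem irreducible_X_pow_two_mul_sub {k F : Type*} [Field k] [Field F] [Algebra k F] {m : ℕ}
    (hm : ((2 * m : ℕ) : k) ≠ 0) {v : F} (hv : Transcendental k v) :
    Irreducible (X ^ (2 * m) - C (AdjoinSimple.gen k v ^ m) * X ^ m - 1 : k⟮v⟯[X]) := by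
  have hm0 : 0 < m := Nat.pos_of_ne_zero (by rintro rfl; simp at hm)
  have h := irreducible_X_pow_two_mul_sub_bivariate hm
  rw [Monic.irreducible_iff_irreducible_map_fraction_map (K := RatFunc k)
    (monic_X_pow_two_mul_sub hm0 _),
    ← MulEquiv.irreducible_iff (mapEquiv (RatFunc.algEquivOfTranscendental v hv).toRingEquiv)] at h
  have hX : RatFunc.algEquivOfTranscendental v hv RatFunc.X = AdjoinSimple.gen k v :=
    Subtype.ext (by simp [RatFunc.algEquivOfTranscendental_X])
  convert h using 1
  simp [hX]

/-- A group of order `2 * m` with an element of order `m` inverted by an involution is dihedral. -/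
theorem nonempty_mulEquiv_dihedralGroup_s9 {G : Type*} [Group G] {m : ℕ} (hm : 2 < m) {σ τ : G}
    (hσ : orderOf σ = m) (hτ : τ * τ = 1) (hτσ : τ * σ * τ = σ⁻¹)
    (hcard : Nat.card G = 2 * m) :
    Nonempty (G ≃* DihedralGroup m) := by
  have : NeZero m := ⟨by omega⟩
  have : Finite G := Nat.finite_of_card_ne_zero (by omega)
  let φ : ZMod m →+ Additive G := ZMod.lift m ⟨zmultiplesHom (Additive G) (Additive.ofMul σ), by
    have := pow_orderOf_eq_one σ
    rw [hσ] at this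
    simp [← ofMul_pow, this]⟩
  let ψ : ZMod m → G := fun i ↦ (φ i).toMul
  have hψ (z : ℤ) : ψ z = σ ^ z := by simp [ψ, φ]
  have hadd (i j : ZMod m) : ψ (i + j) = ψ i * ψ j := by simp [ψ]
  have hmem (i : ZMod m) : ψ i ∈ Subgroup.zpowers σ := by
    obtain ⟨z, rfl⟩ := ZMod.intCast_surjective i
    exact ⟨z, (hψ z).symm⟩
  have hinj (i : ZMod m) (hi : ψ i = 1) : i = 0 := by
    obtain ⟨z, rfl⟩ := ZMod.intCast_surjective i
    rw [hψ, ← orderOf_dvd_iff_zpow_eq_one, hσ] at hi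
    exact (ZMod.intCast_zmod_eq_zero_iff_dvd _ _).2 hi
  have hcomm (i : ZMod m) : ψ i * τ = τ * ψ (-i) := by
    obtain ⟨z, rfl⟩ := ZMod.intCast_surjective i
    have h : SemiconjBy τ σ⁻¹ σ := by
      rw [SemiconjBy, ← hτσ]
      simp [← mul_assoc, hτ]
    rw [← Int.cast_neg, hψ, hψ, ← (h.zpow_right z).eq, inv_zpow']
  let f : DihedralGroup m →* G := MonoidHom.mk'
    (fun | .r i => ψ i | .sr i => τ * ψ i) <| by
      rintro (i | i) (j | j)
      · simp [hadd]
      · simp [← mul_assoc, hcomm, sub_eq_neg_add, hadd]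
      · simp [mul_assoc, hadd]
      · change ψ (j - i) = τ * ψ i * (τ * ψ j)
        rw [mul_assoc, ← mul_assoc (ψ i), hcomm, mul_assoc, ← hadd, ← mul_assoc, hτ, one_mul,
          neg_add_eq_sub]
  have hf : Function.Injective f := by
    rw [injective_iff_map_eq_one]
    rintro (i | i) h
    · rw [hinj i h]; rfl
    · refine absurd ?_ (Nat.not_dvd_of_pos_of_lt two_pos hm)
      suffices hmemτ : τ ∈ Subgroup.zpowers σ by
        obtain ⟨z, rfl⟩ := hmemτ
        rw [← hσ, orderOf_dvd_iff_pow_eq_one, sq, mul_eq_one_iff_eq_inv, ← hτσ,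
          (Commute.zpow_left rfl z).eq, mul_assoc, hτ, mul_one]
      rw [eq_inv_of_mul_eq_one_left (show τ * ψ i = 1 from h)]
      exact inv_mem (hmem i)
  have : Fintype G := Fintype.ofFinite G
  refine ⟨(MulEquiv.ofBijective f <|
    (Fintype.bijective_iff_injective_and_card f).2 ⟨hf, ?_⟩).symm⟩
  rw [← Nat.card_eq_fintype_card, ← Nat.card_eq_fintype_card, hcard, DihedralGroup.nat_card]

/-- If `X ^ (2 * m) - a * X ^ m - 1` is irreducible over `K`, and `K` contains the solutions of
`X ^ m = 1` and `X ^ m = -1`, then adjoining a root gives a dihedral Galois extension. -/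
theorem isGalois_and_dihedral_of_irreducible {K F : Type*} [Field K] [Field F] [Algebra K F]
    {m : ℕ} (hm : 2 < m) (hm' : ((2 * m : ℕ) : K) ≠ 0) {a : K} {t : F}
    (ht : t ^ (2 * m) = algebraMap K F a * t ^ m + 1) (hgen : K⟮t⟯ = ⊤)
    (hirr : Irreducible (X ^ (2 * m) - C a * X ^ m - 1 : K[X])) {ζ θ : K}
    (hζ : IsPrimitiveRoot ζ m) (hθ : θ ^ m = -1) :
    FiniteDimensional K F ∧ IsGalois K F ∧ Nonempty ((F ≃ₐ[K] F) ≃* DihedralGroup m) := by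
  have hm0 : 0 < m := by omega
  have hmonic := monic_X_pow_two_mul_sub hm0 a
  have hdeg := natDegree_X_pow_two_mul_sub hm0 a
  set P : K[X] := X ^ (2 * m) - C a * X ^ m - 1 with hP
  have ht0 : t ≠ 0 := by rintro rfl; simp [hm0.ne'] at ht
  have hroot (z : F) (hz : z ^ (2 * m) = algebraMap K F a * z ^ m + 1) : P = minpoly K z :=
    minpoly.eq_of_irreducible_of_monic hirr (by simp [hP, hz]) hmonic
  have hint : IsIntegral K t := ⟨P, hmonic, by simp [hP, ht]⟩
  have hfin : FiniteDimensional K F := by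
    have := adjoin.finiteDimensional hint
    rw [hgen] at this
    exact (topEquiv (F := K) (E := F)).toLinearEquiv.finiteDimensional
  have htop : Algebra.adjoin K {t} = ⊤ :=
    Algebra.adjoin_eq_top_of_intermediateField
      (fun _ hx ↦ by rw [Set.mem_singleton_iff.1 hx]; exact hint.isAlgebraic) hgen
  have hsep : P.Separable := by
    rw [separable_iff_derivative_ne_zero hirr]
    intro h
    have h2 : (derivative P).coeff (2 * m - 1) = 0 := by rw [h, coeff_zero]
    have h3 : P.coeff (2 * m - 1 + 1) = 1 := by
      rw [Nat.sub_add_cancel (by omega), ← hdeg, ← leadingCoeff, hmonic.leadingCoeff]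
    rw [coeff_derivative, h3, one_mul] at h2
    exact hm' (by rw [← h2]; norm_cast; rw [Nat.sub_add_cancel (by omega)])
  have hζF : IsPrimitiveRoot (algebraMap K F ζ) m := hζ.map_of_injective (algebraMap K F).injective
  have hθF : algebraMap K F θ ^ m = -1 := by rw [← map_pow, hθ, map_neg, map_one]
  have hθ0 : algebraMap K F θ ≠ 0 := by
    intro h; rw [h, zero_pow hm0.ne'] at hθF; simp at hθF
  have : IsSplittingField K F P := by
    constructor
    · have hfac : P.map (algebraMap K F) =
          (X ^ m - C (t ^ m)) * (X ^ m - C ((algebraMap K F θ / t) ^ m)) := by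
        have h1 : t ^ m * (algebraMap K F θ / t) ^ m = -1 := by
          rw [← mul_pow, mul_div_cancel₀ _ ht0, hθF]
        have h2 : t ^ m + (algebraMap K F θ / t) ^ m = algebraMap K F a := by
          have := pow_ne_zero m ht0
          rw [div_pow, hθF]
          field_simp
          linear_combination ht
        have h3 : C (t ^ m) * C ((algebraMap K F θ / t) ^ m) = (-1 : F[X]) := by
          rw [← C_mul, h1, C_neg, C_1]
        simp only [hP, Polynomial.map_sub, Polynomial.map_pow, Polynomial.map_mul, map_X, map_C,
          Polynomial.map_one, ← h2, C_add]
        linear_combination -h3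
      rw [hfac]
      exact (X_pow_sub_C_splits_of_isPrimitiveRoot hζF rfl).mul
        (X_pow_sub_C_splits_of_isPrimitiveRoot hζF rfl)
    · refine top_le_iff.1 (htop.symm.le.trans (Algebra.adjoin_mono ?_))
      rw [Set.singleton_subset_iff, mem_rootSet]
      exact ⟨hmonic.ne_zero, by simp [hP, ht]⟩
  have hgal : IsGalois K F := IsGalois.of_separable_splitting_field hsep
  refine ⟨hfin, hgal, ?_⟩
  have hext {σ τ : F ≃ₐ[K] F} (h : σ t = τ t) : σ = τ := by
    have := AlgHom.ext_of_adjoin_eq_top htop (φ₁ := (σ : F →ₐ[K] F)) (φ₂ := τ) (by simpa using h)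
    exact AlgEquiv.ext fun z ↦ DFunLike.congr_fun this z
  have hconj (z : F) (hz : z ^ (2 * m) = algebraMap K F a * z ^ m + 1) :
      ∃ σ : F ≃ₐ[K] F, σ t = z :=
    isConjRoot_iff_exists_algEquiv.1 ((hroot z hz).symm.trans (hroot t ht))
  obtain ⟨σ, hσ⟩ := hconj (algebraMap K F ζ * t) (by
    rw [mul_pow, mul_pow, pow_mul', hζF.pow_eq_one, one_pow, one_mul, one_mul, ht])
  obtain ⟨τ, hτ⟩ := hconj (algebraMap K F θ / t) (by
    have := pow_ne_zero m ht0
    rw [pow_mul'] at ht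
    rw [pow_mul', div_pow, hθF]
    field_simp
    linear_combination -ht)
  have hσpow (i : ℕ) : (σ ^ i) t = algebraMap K F ζ ^ i * t := by
    induction i with
    | zero => simp
    | succ i ih =>
      rw [pow_succ', AlgEquiv.mul_apply, ih, map_mul, map_pow, AlgEquiv.commutes, hσ]
      ring
  refine nonempty_mulEquiv_dihedralGroup_s9 hm (σ := σ) (τ := τ) ?_ ?_ ?_ ?_
  · refine Nat.dvd_antisymm (orderOf_dvd_of_pow_eq_one (hext ?_)) (hζF.dvd_of_pow_eq_one _ ?_)
    · rw [hσpow, hζF.pow_eq_one, one_mul, AlgEquiv.one_apply]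
    · refine mul_right_cancel₀ ht0 ?_
      rw [← hσpow, pow_orderOf_eq_one, AlgEquiv.one_apply, one_mul]
  · refine hext ?_
    rw [AlgEquiv.mul_apply, hτ, map_div₀, AlgEquiv.commutes, hτ, div_div_cancel₀ hθ0,
      AlgEquiv.one_apply]
  · rw [eq_inv_iff_mul_eq_one]
    refine hext ?_
    have hζ0 : algebraMap K F ζ ≠ 0 := hζF.ne_zero hm0.ne'
    simp only [AlgEquiv.mul_apply, AlgEquiv.one_apply, hσ, hτ, map_div₀, map_mul, AlgEquiv.commutes]
    field_simp
  · rw [IsGalois.card_aut_eq_finrank, ← finrank_top', ← hgen, adjoin.finrank hint, ← hroot t ht,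
      hdeg]

theorem isGalois_and_dihedral_of_transcendental {k F : Type*} [Field k] [IsAlgClosed k] [Field F]
    [Algebra k F] {m : ℕ} (hm : 2 < m) (hm' : ((2 * m : ℕ) : k) ≠ 0) {v t : F}
    (hv : Transcendental k v) (ht : t ^ (2 * m) = v ^ m * t ^ m + 1) (hgen : k⟮v, t⟯ = ⊤) :
    FiniteDimensional k⟮v⟯ F ∧ IsGalois k⟮v⟯ F ∧
      Nonempty ((F ≃ₐ[k⟮v⟯] F) ≃* DihedralGroup m) := by
  have : NeZero (m : k) := ⟨fun h ↦ hm' (by rw [Nat.cast_mul, h, mul_zero])⟩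
  obtain ⟨ζ, hζ⟩ := HasEnoughRootsOfUnity.exists_primitiveRoot k m
  obtain ⟨θ, hθ⟩ := IsAlgClosed.exists_pow_nat_eq (-1 : k) (by omega : 0 < m)
  refine isGalois_and_dihedral_of_irreducible (t := t) (θ := algebraMap k k⟮v⟯ θ) hm ?_ ?_ ?_
    (irreducible_X_pow_two_mul_sub hm' hv)
    (hζ.map_of_injective (algebraMap k k⟮v⟯).injective) ?_
  · rw [← map_natCast (algebraMap k k⟮v⟯)]
    exact (_root_.map_ne_zero _).2 hm'
  · rw [map_pow, AdjoinSimple.algebraMap_gen, ht]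
  · rw [← restrictScalars_eq_top_iff (K := k), adjoin_simple_adjoin_simple, hgen]
  · rw [← map_pow, hθ, map_neg, map_one]

theorem transcendental_of_pow_eq {k F : Type*} [Field k] [IsAlgClosed k] [Field F]
    [Algebra k F] {m : ℕ} (hm : 0 < m) {v t : F} (ht : Transcendental k t)
    (h : t ^ (2 * m) = v ^ m * t ^ m + 1) : Transcendental k v := by
  intro hv
  have hbot := eq_bot_of_isAlgClosed_of_isAlgebraic (algebraicClosure k F)
  obtain ⟨a, rfl⟩ := mem_bot.1 (hbot ▸ mem_algebraicClosure_iff.2 hv)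
  refine ht ⟨X ^ (2 * m) - C (a ^ m) * X ^ m - 1, (monic_X_pow_two_mul_sub hm _).ne_zero, ?_⟩
  simp [h]

/-- Let `α ∈ 𝔽_{q²} \ 𝔽_q` inside `k`, and set
`u = (x² - (α^q + α)x + α^(q+1)) / y ∈ F`.  Then `F` is a finite Galois extension of
`k⟮u⟯` and `Gal(F/k⟮u⟯)` is isomorphic to the dihedral group of order `q + 1`. -/
theorem stmt_9
    (k : Type*) [Field k] [IsAlgClosed k]
    (p : ℕ) [Fact p.Prime] (hp2 : p ≠ 2) [CharP k p]
    (n q : ℕ) (hq : q = p ^ n) (hq5 : 5 ≤ q)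
    (F : Type*) [Field F] [Algebra k F]
    (x y : F) (hx : Transcendental k x)
    (hxy : y ^ ((q + 1) / 2) = x ^ q - x)
    (hgen : adjoin k {x, y} = ⊤)
    (α : k) (hα : α ^ q ^ 2 = α) (hα' : α ^ q ≠ α)
    (A : F) (hA : A = algebraMap k F α)
    (u : F) (hu : u = (x ^ 2 - (A ^ q + A) * x + A ^ (q + 1)) / y) :
    FiniteDimensional k⟮u⟯ F ∧ IsGalois k⟮u⟯ F ∧
      Nonempty ((F ≃ₐ[k⟮u⟯] F) ≃* DihedralGroup ((q + 1) / 2)) := by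
  have hp : p.Prime := Fact.out
  have hodd : Odd q := hq ▸ (hp.odd_of_ne_two hp2).pow
  obtain ⟨m, hm⟩ : ∃ m, q + 1 = 2 * m := (hodd.add_odd odd_one).two_dvd
  have hn : n ≠ 0 := by rintro rfl; simp at hq; omega
  have hcast : ((2 * m : ℕ) : k) ≠ 0 := by
    rw [← hm, hq]
    simp [hn]
  rw [show (q + 1) / 2 = m by omega] at hxy ⊢
  have hm2 : 2 < m := by omega
  have hm0 : m ≠ 0 := by omega
  have : CharP F p := charP_of_injective_algebraMap (algebraMap k F).injective p
  have hfrob (z w : F) : (z - w) ^ q = z ^ q - w ^ q := by rw [hq, sub_pow_char_pow]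
  obtain ⟨B, hB⟩ : ∃ B, B = algebraMap k F (α ^ q) := ⟨_, rfl⟩
  have hAB : A ^ q = B := by rw [hA, hB, map_pow]
  have hBA : B ^ q = A := by rw [hA, hB, ← map_pow, ← pow_mul, ← sq, hα]
  have hne (a : k) : x - algebraMap k F a ≠ 0 := fun h ↦
    hx (by rw [sub_eq_zero.1 h]; exact isAlgebraic_algebraMap a)
  have hxA : x - A ≠ 0 := hA ▸ hne α
  have hxB : x - B ≠ 0 := hB ▸ hne _
  obtain ⟨d, hd⟩ := IsAlgClosed.exists_pow_nat_eq (α ^ q - α) (by omega : 0 < m)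
  have hd0 : d ≠ 0 := by
    rintro rfl
    rw [zero_pow hm0] at hd
    exact hα' (sub_eq_zero.1 hd.symm)
  obtain ⟨D, hD⟩ : ∃ D, D = algebraMap k F d := ⟨_, rfl⟩
  have hD0 : D ≠ 0 := by rw [hD]; exact (_root_.map_ne_zero _).2 hd0
  have hDm : D ^ m = B - A := by rw [hD, ← map_pow, hd, map_sub, hA, hB]
  have hBA0 : B - A ≠ 0 := hDm ▸ pow_ne_zero m hD0
  have hu' : u = (x - A) * (x - B) / y := by rw [hu, pow_succ A, hAB]; ring
  -- The key identity, coming from the Frobenius action on `x - A` and `x - B`.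
  have hkey : (x - A) ^ (2 * m) - (x - B) ^ (2 * m) = (B - A) * (x ^ q - x) := by
    rw [← hm, pow_succ, pow_succ, hfrob, hfrob, hAB, hBA]
    ring
  have hy0 : y ≠ 0 := by
    rintro rfl
    rw [zero_pow hm0] at hxy
    refine hx ⟨X ^ q - X, (monic_X_pow_sub ?_).ne_zero, by simp [← hxy]⟩
    rw [degree_X]
    exact_mod_cast (by omega : 1 < q)
  have hu0 : u ≠ 0 := by
    rw [hu']
    exact div_ne_zero (mul_ne_zero hxA hxB) hy0
  obtain ⟨v, hv⟩ : ∃ v, v = D / u := ⟨_, rfl⟩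
  obtain ⟨t, ht⟩ : ∃ t, t = (x - A) / (x - B) := ⟨_, rfl⟩
  have huv : k⟮u⟯ = k⟮v⟯ := by
    have hDmem (K : IntermediateField k F) : D ∈ K := hD ▸ K.algebraMap_mem d
    refine le_antisymm (adjoin_simple_le_iff.2 ?_) (adjoin_simple_le_iff.2 ?_)
    · rw [show u = D / v by rw [hv, div_div_cancel₀ hD0]]
      exact div_mem (hDmem _) (mem_adjoin_simple_self k v)
    · rw [hv]
      exact div_mem (hDmem _) (mem_adjoin_simple_self k u)
  have htv : t ^ (2 * m) = v ^ m * t ^ m + 1 := by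
    have h1 : v ^ m * t ^ m = (B - A) * (x ^ q - x) / (x - B) ^ (2 * m) := by
      rw [← mul_pow, ← hDm, ← hxy, two_mul, pow_add, ← mul_pow, ← mul_pow, ← div_pow, hv, ht, hu']
      congr 1
      field_simp
    rw [h1, ← hkey, ht, div_pow]
    have := pow_ne_zero (2 * m) hxB
    field_simp
    ring
  have ht1 : t - 1 ≠ 0 := by
    rw [show t - 1 = (B - A) / (x - B) by rw [ht]; field_simp; ring]
    exact div_ne_zero hBA0 hxB
  have hxt : x = (B * t - A) / (t - 1) := by
    rw [eq_div_iff ht1, ht]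
    field_simp
    ring
  have hxK {K : IntermediateField k F} (h : t ∈ K) : x ∈ K := by
    have hAK : A ∈ K := hA ▸ K.algebraMap_mem _
    have hBK : B ∈ K := hB ▸ K.algebraMap_mem _
    rw [hxt]
    exact div_mem (sub_mem (mul_mem hBK h) hAK) (sub_mem h K.one_mem)
  have httrans : Transcendental k t := fun h ↦ hx <| by
    rw [← mem_algebraicClosure_iff] at h ⊢
    exact hxK h
  rw [huv]
  refine isGalois_and_dihedral_of_transcendental hm2 hcast
    (transcendental_of_pow_eq (by omega) httrans htv) htv (top_le_iff.1 (hgen ▸ ?_))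
  have htK : t ∈ k⟮v, t⟯ := subset_adjoin k _ (by simp)
  have huK : u ∈ k⟮v, t⟯ := adjoin.mono k {v} _ (by simp) (huv ▸ mem_adjoin_simple_self k u)
  have hAK : A ∈ k⟮v, t⟯ := hA ▸ IntermediateField.algebraMap_mem _ _
  have hBK : B ∈ k⟮v, t⟯ := hB ▸ IntermediateField.algebraMap_mem _ _
  rw [adjoin_le_iff, Set.insert_subset_iff, Set.singleton_subset_iff]
  refine ⟨hxK htK, ?_⟩
  rw [SetLike.mem_coe, show y = (x - A) * (x - B) / u by rw [hu']; field_simp]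
  exact div_mem (mul_mem (sub_mem (hxK htK) hAK) (sub_mem (hxK htK) hBK)) huK
end

section
/- Let α ∈ k satisfy α^(q²) = α and α^q ≠ α, and let f ∈ k satisfy f^((q+1)/2) = −1. Then there is a k-algebra field automorphism τ of F determined by τ(x) = ((α^q − f·α)·x + (−α^(2q) + f·α²)) / ((1 − f)·x + (−α^q + f·α)) and τ(y) = f·(α^q − α)²·y / ((1 − f)·x + (−α^q + f·α))², and τ fixes the element u = (x² − (α^q + α)·x + α^(q+1)) / y. -/
open IntermediateField Polynomial

theorem irreducible_X_pow_sub_C_of_coeff_zero_of_coeff_one {k : Type*} [Field k] {m : ℕ}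
    (hm : 0 < m) {g : k[X]} (hg0 : g.coeff 0 = 0) (hg1 : g.coeff 1 ≠ 0) :
    Irreducible (X ^ m - C g : k[X][X]) := by
  have hmonic : (X ^ m - C g : k[X][X]).Monic := monic_X_pow_sub_C g hm.ne'
  have hdeg : (X ^ m - C g : k[X][X]).natDegree = m := natDegree_X_pow_sub_C
  have hprime : (Ideal.span {X} : Ideal k[X]).IsPrime :=
    (Ideal.span_singleton_prime X_ne_zero).2 prime_X
  refine IsEisensteinAt.irreducible (𝓟 := Ideal.span {X}) ⟨?_, ?_, ?_⟩ hprime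
    hmonic.isPrimitive (hdeg.symm ▸ hm)
  · rw [hmonic.leadingCoeff]
    exact (Ideal.ne_top_iff_one _).1 hprime.ne_top
  · intro i hi
    rw [hdeg] at hi
    rw [Ideal.mem_span_singleton, coeff_sub, coeff_X_pow, if_neg hi.ne, coeff_C]
    split_ifs
    · simpa [X_dvd_iff] using hg0
    · simp
  · rw [Ideal.span_singleton_pow, Ideal.mem_span_singleton, coeff_sub, coeff_X_pow,
      if_neg hm.ne, coeff_C_zero, zero_sub, dvd_neg, X_pow_dvd_iff]
    exact fun h => hg1 (h 1 one_lt_two)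

/-- The kernel of evaluation at a point of `Y ^ m = g(X)` with transcendental first coordinate. -/
theorem aevalAeval_eq_zero_iff_dvd {k F : Type*} [Field k] [Field F] [Algebra k F] {m : ℕ}
    (hm : 0 < m) {g : k[X]} (hg0 : g.coeff 0 = 0) (hg1 : g.coeff 1 ≠ 0)
    {x y : F} (hx : Transcendental k x) (hxy : y ^ m = aeval x g) (P : k[X][X]) :
    aevalAeval x y P = 0 ↔ X ^ m - C g ∣ P := by
  have hG : aevalAeval x y (X ^ m - C g : k[X][X]) = 0 := by
    rw [map_sub, map_pow, aevalAeval_Y, aevalAeval_C, hxy, sub_self]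
  constructor
  · intro hP
    let _ : Algebra k[X] F := (aeval x).toAlgebra
    have hinj : Function.Injective (algebraMap k[X] F) := transcendental_iff_injective.1 hx
    have : FaithfulSMul k[X] F := (faithfulSMul_iff_algebraMap_injective _ _).2 hinj
    have key : ∀ Q : k[X][X], aeval y Q = aevalAeval x y Q := by
      intro Q
      induction Q using Polynomial.induction_on' with
      | add a b ha hb => rw [map_add, map_add, ha, hb]
      | monomial i a =>
        rw [← C_mul_X_pow_eq_monomial, map_mul, map_mul, map_pow, map_pow, aevalAeval_C,
          aevalAeval_Y, aeval_X, aeval_C]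
        rfl
    have hmonic : (X ^ m - C g : k[X][X]).Monic := monic_X_pow_sub_C g hm.ne'
    have hint : IsIntegral k[X] y := ⟨_, hmonic, (key _).trans hG⟩
    have h1 := minpoly.isIntegrallyClosed_dvd hint ((key _).trans hG)
    have h2 := minpoly.isIntegrallyClosed_dvd hint ((key _).trans hP)
    have hirr := irreducible_X_pow_sub_C_of_coeff_zero_of_coeff_one hm hg0 hg1
    exact ((hirr.dvd_iff.1 h1).resolve_left (minpoly.not_isUnit _ _)).dvd.trans h2
  · rintro ⟨Q, rfl⟩
    rw [map_mul, hG, zero_mul]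

/-- A field generated by `x` and `y` maps to any field containing elements that satisfy the same
algebraic relations. -/
theorem exists_algHom_of_aevalAeval_eq_zero_iff {k F E : Type*} [Field k] [Field F] [Algebra k F]
    [Field E] [Algebra k E] {x y : F} {x' y' : E} (hgen : adjoin k {x, y} = ⊤)
    (h : ∀ P : k[X][X], aevalAeval x y P = 0 ↔ aevalAeval x' y' P = 0) :
    ∃ τ : F →ₐ[k] E, τ x = x' ∧ τ y = y' := by
  let φ : k[X][X] →ₐ[k] F := aevalAeval x y
  let φ' : k[X][X] →ₐ[k] E := aevalAeval x' y'
  let R := k[X][X] ⧸ RingHom.ker φ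
  let ψ : R →ₐ[k] E := Ideal.Quotient.liftₐ _ φ' fun P hP => (h P).1 hP
  let _ : Algebra R F := (Ideal.kerLiftAlg φ).toAlgebra
  have hmap : ∀ P, algebraMap R F (Ideal.Quotient.mk _ P) = φ P := fun P => by
    rw [RingHom.algebraMap_toAlgebra]
    exact Ideal.kerLiftAlg_mk φ P
  have : IsScalarTower k R F :=
    IsScalarTower.of_algebraMap_eq (R := k) (S := R) (A := F) fun c => ((Ideal.kerLiftAlg φ).commutes c).symm
  have : FaithfulSMul R F :=
    (faithfulSMul_iff_algebraMap_injective _ _).2 (Ideal.kerLiftAlg_injective φ)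
  have hψ : Function.Injective ψ := by
    rw [injective_iff_map_eq_zero]
    intro a ha
    obtain ⟨P, rfl⟩ := Ideal.Quotient.mk_surjective a
    exact Ideal.Quotient.eq_zero_iff_mem.2 ((h P).2 ha)
  have hrange : Algebra.adjoin k {x, y} ≤ φ.range := by
    rw [Algebra.adjoin_le_iff]
    rintro z (rfl | rfl)
    · exact ⟨C X, aevalAeval_X _ _⟩
    · exact ⟨X, aevalAeval_Y _ _⟩
  have : IsFractionRing R F := by
    refine IsFractionRing.of_field R F fun z => ?_
    obtain ⟨r, hr, s, hs, rfl⟩ := (mem_adjoin_iff_div (F := k)).1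
      (hgen ▸ mem_top : z ∈ adjoin k {x, y})
    obtain ⟨P, rfl⟩ := hrange hr
    obtain ⟨Q, rfl⟩ := hrange hs
    exact ⟨Ideal.Quotient.mk _ P, Ideal.Quotient.mk _ Q, by rw [hmap, hmap]; rfl⟩
  have hτ : ∀ P, IsFractionRing.liftAlgHom (R := k) (A := R) (K := F) hψ (φ P) = φ' P := fun P => by
    rw [← hmap, IsFractionRing.coe_liftAlgHom, IsFractionRing.lift_algebraMap]
    rfl
  refine ⟨IsFractionRing.liftAlgHom (R := k) (A := R) hψ, ?_, ?_⟩
  · simpa only [φ, φ', aevalAeval_X] using hτ (C X)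
  · simpa only [φ, φ', aevalAeval_Y] using hτ X

/-- A `k`-endomorphism that is an involution on generators is an automorphism. -/
theorem exists_algEquiv_of_involutive_on_generators {k F : Type*} [Field k] [Field F]
    [Algebra k F] {s : Set F} (hgen : adjoin k s = ⊤) (τ : F →ₐ[k] F)
    (h : ∀ z ∈ s, τ (τ z) = z) : ∃ σ : F ≃ₐ[k] F, ∀ z, σ z = τ z := by
  have hinv : ∀ z, τ (τ z) = z := fun z => by
    have hz : z ∈ adjoin k s := hgen ▸ mem_top
    induction hz using adjoin_induction with
    | mem z hz => exact h z hz
    | algebraMap c => simp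
    | add a b _ _ ha hb => simp [ha, hb]
    | inv a _ ha => simp [ha]
    | mul a b _ _ ha hb => simp [ha, hb]
  exact ⟨AlgEquiv.ofAlgHom τ τ (AlgHom.ext hinv) (AlgHom.ext hinv), fun _ => rfl⟩

/-- Let `α ∈ 𝔽_{q²} \ 𝔽_q` inside `k` and let `f ∈ k` satisfy
`f^((q+1)/2) = -1`.  Then there is a `k`-algebra automorphism `τ` of `F` with
`τ(x) = ((α^q - fα)x + (-α^(2q) + fα²)) / ((1 - f)x + (-α^q + fα))` and
`τ(y) = f(α^q - α)² y / ((1 - f)x + (-α^q + fα))²`, and `τ` fixes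
`u = (x² - (α^q + α)x + α^(q+1)) / y`. -/
theorem stmt_10
    (k : Type*) [Field k] [IsAlgClosed k]
    (p : ℕ) [Fact p.Prime] (hp2 : p ≠ 2) [CharP k p]
    (n q : ℕ) (hq : q = p ^ n) (hq5 : 5 ≤ q)
    (F : Type*) [Field F] [Algebra k F]
    (x y : F) (hx : Transcendental k x)
    (hxy : y ^ ((q + 1) / 2) = x ^ q - x)
    (hgen : adjoin k {x, y} = ⊤)
    (α : k) (hα : α ^ q ^ 2 = α) (hα' : α ^ q ≠ α)
    (f : k) (hf : f ^ ((q + 1) / 2) = -1)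
    (A Fk : F) (hA : A = algebraMap k F α) (hFk : Fk = algebraMap k F f)
    (u : F) (hu : u = (x ^ 2 - (A ^ q + A) * x + A ^ (q + 1)) / y) :
    ∃ τ : F ≃ₐ[k] F,
      τ x = ((A ^ q - Fk * A) * x + (-(A ^ (2 * q)) + Fk * A ^ 2))
              / ((1 - Fk) * x + (-(A ^ q) + Fk * A)) ∧
      τ y = Fk * (A ^ q - A) ^ 2 * y / ((1 - Fk) * x + (-(A ^ q) + Fk * A)) ^ 2 ∧
      τ u = u := by
  obtain ⟨h, hh⟩ : Odd q := hq ▸ ((Fact.out : p.Prime).odd_of_ne_two hp2).pow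
  set m := (q + 1) / 2 with hm
  have hm2 : m * 2 = q + 1 := by omega
  have : CharP F p := charP_of_injective_algebraMap (algebraMap k F).injective p
  have frob_sub : ∀ a b : F, (a - b) ^ q = a ^ q - b ^ q := fun a b => by
    rw [hq, sub_pow_char_pow]
  set B : F := A ^ q with hB
  have hBq : B ^ q = A := by
    rw [hB, ← pow_mul, ← sq, hA, ← map_pow, hα]
  have hBA : B - A ≠ 0 := by
    rw [hB, hA, ← map_pow, sub_ne_zero]
    exact (algebraMap k F).injective.ne hα'
  have hFm : Fk ^ m = -1 := by rw [hFk, ← map_pow, hf, map_neg, map_one]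
  have hF1 : Fk ^ q * Fk = 1 := by
    rw [← pow_succ, ← hm2, pow_mul, hFm]; norm_num
  have hF0 : Fk ≠ 0 := right_ne_zero_of_mul_eq_one hF1
  have hA2 : A ^ (2 * q) = B ^ 2 := by rw [hB, ← pow_mul, mul_comm]
  have hA1 : A ^ (q + 1) = B * A := pow_succ _ _
  have hAalg : IsAlgebraic k A := hA ▸ isAlgebraic_algebraMap α
  have hFalg : IsAlgebraic k Fk := hFk ▸ isAlgebraic_algebraMap f
  have hBalg : IsAlgebraic k B := hAalg.pow q
  have hτA : ∀ τ : F →ₐ[k] F, τ A = A := fun τ => by rw [hA, τ.commutes]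
  have hτF : ∀ τ : F →ₐ[k] F, τ Fk = Fk := fun τ => by rw [hFk, τ.commutes]
  have hτB : ∀ τ : F →ₐ[k] F, τ B = B := fun τ => by rw [hB, map_pow, hτA]
  rw [hA2]
  rw [hA1] at hu
  clear_value B m
  set N := (B - Fk * A) * x + (-B ^ 2 + Fk * A ^ 2) with hN
  set D := (1 - Fk) * x + (-B + Fk * A) with hD
  clear_value N D
  have hdet : (1 - Fk) * N + (-B + Fk * A) * D = Fk * (B - A) ^ 2 := by rw [hN, hD]; ring
  have hdet0 : Fk * (B - A) ^ 2 ≠ 0 := mul_ne_zero hF0 (pow_ne_zero 2 hBA)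
  have hxnot : ∀ c : F, IsAlgebraic k c → x ≠ c := fun c hc h => hx (h ▸ hc)
  have hD0 : D ≠ 0 := by
    intro h0
    by_cases h1 : 1 - Fk = 0
    · rw [h1, h0] at hdet
      exact hdet0 (by rw [← hdet]; ring)
    · refine hxnot ((B - Fk * A) * (1 - Fk)⁻¹) ?_ ?_
      · exact (hBalg.sub (hFalg.mul hAalg)).mul (isAlgebraic_one.sub hFalg).inv
      · field_simp
        linear_combination h0 - hD
  have hx0 : x ^ q - x ≠ 0 := by
    intro h0
    refine hx ⟨X ^ q - X, ?_, by simpa using h0⟩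
    exact FiniteField.X_pow_card_sub_X_ne_zero k (by omega)
  have hy0 : y ≠ 0 := by
    rintro rfl
    exact hx0 (by rw [← hxy, zero_pow (by omega)])
  have hDinv : (1 - Fk) * (N / D) + (-B + Fk * A) = Fk * (B - A) ^ 2 / D := by
    rw [← hdet]; field_simp
  have hNinv : (B - Fk * A) * (N / D) + (-B ^ 2 + Fk * A ^ 2) = Fk * (B - A) ^ 2 * x / D := by
    rw [hN]
    field_simp
    rw [hD]
    ring
  have hxx : ((B - Fk * A) * (N / D) + (-B ^ 2 + Fk * A ^ 2)) /
      ((1 - Fk) * (N / D) + (-B + Fk * A)) = x := by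
    rw [hDinv, hNinv]; field_simp
  have hx' : Transcendental k (N / D) := by
    intro h
    refine hx ?_
    rw [← hxx, div_eq_mul_inv]
    exact (((hBalg.sub (hFalg.mul hAalg)).mul h).add
      ((hBalg.pow 2).neg.add (hFalg.mul (hAalg.pow 2)))).mul
      (((isAlgebraic_one.sub hFalg).mul h).add (hBalg.neg.add (hFalg.mul hAalg))).inv
  have hcurve : N ^ q * D - N * D ^ q = (B - A) ^ 2 * (x ^ q - x) := by
    have hNq : Fk * N ^ q = -((B - Fk * A) * x ^ q + (-B ^ 2 + Fk * A ^ 2)) := by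
      have e : N = (B - Fk * A) * x - (B ^ 2 - Fk * A ^ 2) := by rw [hN]; ring
      rw [e, frob_sub, frob_sub, mul_pow, mul_pow, frob_sub, mul_pow, ← pow_mul, mul_comm 2 q,
        pow_mul, ← pow_mul A, mul_comm 2 q, pow_mul A, hBq, ← hB]
      linear_combination (-B * x ^ q + B ^ 2) * hF1
    have hDq : Fk * D ^ q = -((1 - Fk) * x ^ q + (-B + Fk * A)) := by
      have e : D = (1 - Fk) * x - (B - Fk * A) := by rw [hD]; ring
      rw [e, frob_sub, frob_sub, mul_pow, mul_pow, frob_sub, one_pow, hBq, ← hB]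
      linear_combination (-x ^ q + B) * hF1
    apply mul_left_cancel₀ hF0
    rw [mul_sub, ← mul_assoc, hNq, mul_left_comm, hDq, hN, hD]
    ring
  have hBA2 : (B - A) ^ (m * 2) = -(B - A) ^ 2 := by
    rw [hm2, pow_succ, frob_sub, hBq, ← hB]; ring
  have hxy' : (Fk * (B - A) ^ 2 * y / D ^ 2) ^ m = (N / D) ^ q - N / D := by
    have hdiff : N ^ q / D ^ q - N / D = (B - A) ^ 2 * (x ^ q - x) / D ^ (q + 1) := by
      rw [← hcurve]
      field_simp
      ring
    rw [div_pow, mul_pow, mul_pow, hFm, hxy, ← pow_mul, ← pow_mul, mul_comm 2 m, hBA2, hm2,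
      div_pow, hdiff]
    ring
  have hm0 : 0 < m := by omega
  have hg0 : (X ^ q - X : k[X]).coeff 0 = 0 := by
    simp [coeff_X_pow, show (0 : ℕ) ≠ q by omega]
  have hg1 : (X ^ q - X : k[X]).coeff 1 ≠ 0 := by
    simp [coeff_X_pow, show (1 : ℕ) ≠ q by omega]
  obtain ⟨τ, hτx, hτy⟩ := exists_algHom_of_aevalAeval_eq_zero_iff hgen fun P =>
    (aevalAeval_eq_zero_iff_dvd hm0 hg0 hg1 hx (by simpa using hxy) P).trans
      (aevalAeval_eq_zero_iff_dvd hm0 hg0 hg1 hx' (by simpa using hxy') P).symm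
  have hτD : τ D = Fk * (B - A) ^ 2 / D := by
    rw [← hDinv]
    conv_lhs => rw [hD]
    simp only [map_add, map_mul, map_sub, map_neg, map_one, hτA, hτB, hτF, hτx]
  have hτN : τ N = Fk * (B - A) ^ 2 * x / D := by
    rw [← hNinv]
    conv_lhs => rw [hN]
    simp only [map_add, map_mul, map_sub, map_neg, map_pow, hτA, hτB, hτF, hτx]
  have hinv : ∀ z ∈ ({x, y} : Set F), τ (τ z) = z := by
    rintro z (rfl | rfl)
    · rw [hτx, map_div₀, hτD, hτN]
      field_simp
    · simp only [hτy, map_div₀, map_mul, map_pow, map_sub, hτA, hτB, hτF, hτD]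
      field_simp
  obtain ⟨σ, hσ⟩ := exists_algEquiv_of_involutive_on_generators hgen τ hinv
  refine ⟨σ, (hσ x).trans hτx, (hσ y).trans hτy, ?_⟩
  rw [hσ, hu]
  simp only [map_div₀, map_mul, map_add, map_sub, map_pow, hτA, hτB, hτx, hτy]
  field_simp
  rw [hN, hD]
  ring
end

section
/- Let α ∈ k satisfy α^(q²) = α and α^q ≠ α, and set u = (x − α)² / y ∈ F. Then F is a finite Galois extension of the intermediate field k⟮u⟯ generated by k and u, and Gal(F/k⟮u⟯) is cyclic of order q+1. -/
open IntermediateField Polynomial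

/-- A Kummer extension given by an explicit generator is Galois with cyclic Galois group. -/
theorem isGalois_isCyclic_of_adjoin_eq_top_of_pow_eq {K L : Type*} [Field K] [Field L]
    [Algebra K L] {N : ℕ} (hζ : (primitiveRoots N K).Nonempty) {a : K}
    (H : Irreducible (X ^ N - C a)) {s : L} (hs : s ^ N = algebraMap K L a) (hgen : K⟮s⟯ = ⊤) :
    FiniteDimensional K L ∧ IsGalois K L ∧ IsCyclic (L ≃ₐ[K] L) ∧ Nat.card (L ≃ₐ[K] L) = N := by
  have hN : N ≠ 0 := ne_zero_of_irreducible_X_pow_sub_C H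
  have : NeZero N := ⟨hN⟩
  have hmonic : (X ^ N - C a).Monic := monic_X_pow_sub_C a hN
  have hroot : aeval s (X ^ N - C a) = 0 := by simp [hs]
  have hint : IsIntegral K s := ⟨_, hmonic, by simpa [aeval_def] using hroot⟩
  have hfin : FiniteDimensional K L := by
    have := adjoin.finiteDimensional hint
    rw [hgen] at this
    exact Module.Finite.equiv (topEquiv (F := K) (E := L)).toLinearEquiv
  have hrank : Module.finrank K L = N := by
    rw [← finrank_top', ← hgen, adjoin.finrank hint,
      ← minpoly.eq_of_irreducible_of_monic H hroot hmonic, natDegree_X_pow_sub_C]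
  have hsplit : IsSplittingField K L (X ^ N - C a) := by
    have := isSplittingField_X_pow_sub_C_of_root_adjoin_eq_top (K := K) (L := L)
      (by rwa [hrank]) (a := a) (α := s) (by rwa [hrank]) hgen
    rwa [hrank] at this
  have hgal := isGalois_of_isSplittingField_X_pow_sub_C hζ H L
  exact ⟨hfin, hgal, isCyclic_of_isSplittingField_X_pow_sub_C hζ H L,
    by rw [IsGalois.card_aut_eq_finrank, hrank]⟩

/-- If `b` has a simple root, then `Y ^ N - b` is irreducible. -/
theorem irreducible_X_pow_sub_C_of_isRoot {k : Type*} [Field k] {N : ℕ} (hN : N ≠ 0) {b : k[X]}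
    {z : k} (hz : b.IsRoot z) (hz' : ¬ (derivative b).IsRoot z) :
    Irreducible (X ^ N - C b) := by
  have hmonic : (X ^ N - C b).Monic := monic_X_pow_sub_C b hN
  have hprime : (Ideal.span {X - C z}).IsPrime :=
    (Ideal.span_singleton_prime (X_sub_C_ne_zero z)).2 (prime_X_sub_C z)
  refine irreducible_of_eisenstein_criterion hprime ?_ ?_ ?_ ?_ hmonic.isPrimitive
  · rw [hmonic.leadingCoeff, ← Ideal.eq_top_iff_one]
    exact hprime.ne_top
  · intro i hi
    rw [degree_X_pow_sub_C (Nat.pos_of_ne_zero hN)] at hi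
    have hi : i ≠ N := by
      have : i < N := by exact_mod_cast hi
      exact this.ne
    rw [coeff_sub, coeff_X_pow, if_neg hi, coeff_C, zero_sub, neg_mem_iff]
    split_ifs
    · exact Ideal.mem_span_singleton.2 (dvd_iff_isRoot.2 hz)
    · exact zero_mem _
  · rw [degree_X_pow_sub_C (Nat.pos_of_ne_zero hN)]
    exact_mod_cast Nat.pos_of_ne_zero hN
  · rw [coeff_sub, coeff_X_pow, if_neg hN.symm, coeff_C_zero, zero_sub, neg_mem_iff,
      Ideal.span_singleton_pow, Ideal.mem_span_singleton]
    intro h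
    exact hz' (dvd_iff_isRoot.1 (by simpa using pow_sub_one_dvd_derivative_of_pow_dvd h))

/-- Transfer of irreducibility from `k[X][Y]` to `k(u)[Y]` for a transcendental element `u`. -/
theorem irreducible_X_pow_sub_C_aeval_gen {k F : Type*} [Field k] [Field F] [Algebra k F] {u : F}
    (hu : Transcendental k u) {N : ℕ} (hN : N ≠ 0) {b : k[X]}
    (H : Irreducible (X ^ N - C b)) :
    Irreducible (X ^ N - C (aeval (AdjoinSimple.gen k u) b)) := by
  have hmonic : (X ^ N - C b).Monic := monic_X_pow_sub_C b hN
  have h := (hmonic.irreducible_iff_irreducible_map_fraction_map (K := RatFunc k)).1 H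
  let e := RatFunc.algEquivOfTranscendental u hu
  have h' := (MulEquiv.irreducible_iff (mapEquiv e.toRingEquiv)).2 h
  convert h' using 1
  have : e (algebraMap k[X] (RatFunc k) b) = aeval (AdjoinSimple.gen k u) b :=
    RatFunc.algEquivOfTranscendental_algebraMap _ _ _
  simp [this]

theorem stmt_11
    (k : Type*) [Field k] [IsAlgClosed k]
    (p : ℕ) [Fact p.Prime] (hp2 : p ≠ 2) [CharP k p]
    (n q : ℕ) (hq : q = p ^ n) (hq5 : 5 ≤ q)
    (F : Type*) [Field F] [Algebra k F]
    (x y : F) (hx : Transcendental k x)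
    (hxy : y ^ ((q + 1) / 2) = x ^ q - x)
    (hgen : adjoin k {x, y} = ⊤)
    (α : k) (hα : α ^ q ^ 2 = α) (hα' : α ^ q ≠ α)
    (u : F) (hu : u = (x - algebraMap k F α) ^ 2 / y) :
    FiniteDimensional k⟮u⟯ F ∧ IsGalois k⟮u⟯ F ∧
      IsCyclic (F ≃ₐ[k⟮u⟯] F) ∧ Nat.card (F ≃ₐ[k⟮u⟯] F) = q + 1 := by
  have hp : p.Prime := Fact.out
  have hn : n ≠ 0 := by
    rintro rfl
    simp at hq
    omega
  have hqk : (q : k) = 0 := by rw [hq]; simp [hn]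
  have hodd : Odd q := hq ▸ (hp.odd_of_ne_two hp2).pow
  obtain ⟨m, hm⟩ : ∃ m, q + 1 = 2 * m := by
    obtain ⟨r, hr⟩ := hodd
    exact ⟨r + 1, by omega⟩
  have hmq : (q + 1) / 2 = m := by omega
  rw [hmq] at hxy
  have hm0 : m ≠ 0 := by omega
  have hmk : (m : k) ≠ 0 := by
    intro h
    have : ((q + 1 : ℕ) : k) = ((2 * m : ℕ) : k) := by rw [hm]
    push_cast at this
    simp [hqk, h] at this
  have : CharP F p := charP_of_injective_algebraMap (algebraMap k F).injective p
  have hne (c : k) : x - algebraMap k F c ≠ 0 := fun h =>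
    hx (sub_eq_zero.1 h ▸ isAlgebraic_algebraMap c)
  set β : k := α ^ q with hβ
  have hβq : β ^ q = α := by rw [hβ, ← pow_mul, ← sq, hα]
  set A := algebraMap k F α with hA
  set B := algebraMap k F β with hB
  have hAB : A - B ≠ 0 := sub_ne_zero.2 fun h => hα' ((algebraMap k F).injective h).symm
  have hAq : A ^ q = B := by rw [hA, ← map_pow]
  have hBq : B ^ q = A := by rw [hB, ← map_pow, hβq]
  have frob (c : F) : (x - c) ^ q = x ^ q - c ^ q := by rw [hq]; exact sub_pow_char_pow ..
  have hy : y ≠ 0 := by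
    rintro rfl
    rw [zero_pow hm0] at hxy
    refine hx ⟨X ^ q - X, FiniteField.X_pow_card_sub_X_ne_zero k (by omega), ?_⟩
    simp [← hxy]
  have hxα : x - A ≠ 0 := hne α
  have hu0 : u ≠ 0 := hu ▸ div_ne_zero (pow_ne_zero _ hxα) hy
  set t : F := (x - B) / (x - A) with ht
  have hx_eq : x = A + (A - B) / (t - 1) := by
    have : t - 1 = (A - B) / (x - A) := by rw [ht]; field_simp; ring
    rw [this]
    field_simp
    ring
  have hy_eq : y = (x - A) ^ 2 / u := by rw [hu]; field_simp
  have hum : u ^ m * y ^ m = (x - A) ^ (q + 1) := by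
    rw [hu, div_pow, ← pow_mul, ← hm]
    field_simp
  have hst : (u * t) ^ (q + 1) = u ^ m * (u ^ m - (B - A)) := by
    have h1 : (x - B) ^ (q + 1) = (x - A) ^ (q + 1) - (B - A) * y ^ m := by
      rw [pow_succ, pow_succ, frob, frob, hAq, hBq, hxy]
      ring
    have h2 : u ^ (q + 1) = u ^ m * u ^ m := by rw [hm]; ring
    rw [mul_pow, h2, ht, div_pow, h1, ← hum]
    field_simp
  have hu_tr : Transcendental k u := by
    intro hua
    have hu_mem : u ∈ algebraicClosure k F := mem_algebraicClosure_iff.2 hua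
    have hA_mem : A ∈ algebraicClosure k F := IntermediateField.algebraMap_mem _ α
    have hB_mem : B ∈ algebraicClosure k F := IntermediateField.algebraMap_mem _ β
    have hs_mem : u * t ∈ algebraicClosure k F := by
      refine mem_algebraicClosure_iff.2 (IsAlgebraic.of_pow (Nat.succ_pos q) ?_)
      rw [Nat.succ_eq_add_one, hst, ← mem_algebraicClosure_iff]
      exact mul_mem (pow_mem hu_mem _) (sub_mem (pow_mem hu_mem _) (sub_mem hB_mem hA_mem))
    have ht_mem : t ∈ algebraicClosure k F := by
      have := mul_mem (inv_mem hu_mem) hs_mem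
      rwa [inv_mul_cancel_left₀ hu0] at this
    refine hx (mem_algebraicClosure_iff.1 ?_)
    rw [hx_eq]
    exact add_mem hA_mem (div_mem (sub_mem hA_mem hB_mem) (sub_mem ht_mem (one_mem _)))
  obtain ⟨z, hz⟩ := IsAlgClosed.exists_pow_nat_eq (β - α) (Nat.pos_of_ne_zero hm0)
  have hz0 : z ≠ 0 := by
    rintro rfl
    rw [zero_pow hm0] at hz
    exact hα' (sub_eq_zero.1 hz.symm)
  have hirr := irreducible_X_pow_sub_C_aeval_gen hu_tr q.succ_ne_zero
    (irreducible_X_pow_sub_C_of_isRoot q.succ_ne_zero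
      (b := X ^ m * (X ^ m - C (β - α))) (z := z) (by simp [hz])
      (by simp [derivative_X_pow, hz, hmk, hz0, sub_ne_zero.2 hα']))
  have hζ : (primitiveRoots (q + 1) k⟮u⟯).Nonempty := by
    have : NeZero ((q + 1 : ℕ) : k) := ⟨by simp [hqk]⟩
    obtain ⟨ζ, hζ⟩ := HasEnoughRootsOfUnity.exists_primitiveRoot k (q + 1)
    exact ⟨_, (mem_primitiveRoots (Nat.succ_pos q)).2
      (hζ.map_of_injective (algebraMap k k⟮u⟯).injective)⟩
  refine isGalois_isCyclic_of_adjoin_eq_top_of_pow_eq hζ hirr (s := u * t) ?_ ?_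
  · rw [hst, ← aeval_algebraMap_apply]
    simp [hA, hB]
  · set E := k⟮u⟯⟮u * t⟯
    have hk_mem (c : k) : algebraMap k F c ∈ E := by
      rw [IsScalarTower.algebraMap_apply k k⟮u⟯ F]
      exact IntermediateField.algebraMap_mem E _
    have hu_mem : u ∈ E := IntermediateField.algebraMap_mem E (AdjoinSimple.gen k u)
    have ht_mem : t ∈ E := by
      have := mul_mem (inv_mem hu_mem) (mem_adjoin_simple_self k⟮u⟯ (u * t))
      rwa [inv_mul_cancel_left₀ hu0] at this
    have hx_mem : x ∈ E := by
      rw [hx_eq]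
      exact add_mem (hk_mem α) (div_mem (sub_mem (hk_mem α) (hk_mem β))
        (sub_mem ht_mem (one_mem _)))
    have hy_mem : y ∈ E := by
      rw [hy_eq]
      exact div_mem (pow_mem (sub_mem hx_mem (hk_mem α)) _) hu_mem
    have hle : adjoin k {x, y} ≤ E.restrictScalars k := by
      rw [adjoin_le_iff]
      rintro w (rfl | rfl)
      · exact hx_mem
      · exact hy_mem
    rw [hgen] at hle
    exact eq_top_iff.2 fun w _ => hle (mem_top (F := k) (x := w))
end

section
/- Let F' = k(t, y) be the function field of the curve y^(q+1) = t^q − 2·t^((q+1)/2) + t. Then F' is a finite Galois extension of the intermediate field k⟮y⟯ generated by k and y, and Gal(F'/k⟮y⟯) is isomorphic to the additive group of the finite field with q elements. -/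
open IntermediateField Polynomial

theorem irreducible_X_pow_sub_X_sub_C_X_pow {k : Type*} [Field k] {q m : ℕ} (hq : 1 < q)
    (hm : 0 < m) : Irreducible (X ^ q - X - C (X ^ m) : k[X][X]) := by
  have hE : Irreducible (X ^ m - C (X ^ q - X) : k[X][X]) := by
    have hP : (Ideal.span {X} : Ideal k[X]).IsPrime :=
      (Ideal.span_singleton_prime X_ne_zero).2 prime_X
    have hmon : (X ^ m - C (X ^ q - X) : k[X][X]).Monic := monic_X_pow_sub_C _ hm.ne'
    have hdeg : (X ^ m - C (X ^ q - X) : k[X][X]).natDegree = m := natDegree_X_pow_sub_C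
    have hE : (X ^ m - C (X ^ q - X) : k[X][X]).IsEisensteinAt (Ideal.span {X}) := by
      refine ⟨?_, fun {i} hi => ?_, ?_⟩
      · rw [hmon.leadingCoeff]
        exact (Ideal.ne_top_iff_one _).1 hP.ne_top
      · rw [hdeg] at hi
        rw [coeff_sub, coeff_X_pow, if_neg hi.ne, zero_sub, neg_mem_iff, coeff_C]
        split_ifs
        · rw [Ideal.mem_span_singleton]
          exact dvd_sub (dvd_pow_self X (by lia)) dvd_rfl
        · exact zero_mem _
      · rw [coeff_sub, coeff_X_pow, if_neg hm.ne, zero_sub, neg_mem_iff, coeff_C_zero,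
          Ideal.span_singleton_pow, Ideal.mem_span_singleton, X_pow_dvd_iff]
        intro h
        simpa [coeff_X_pow, hq.ne] using h 1 (by lia)
    exact hE.irreducible hP hmon.isPrimitive (by rwa [hdeg])
  have h := (Associated.refl _).neg_right.irreducible hE
  rw [← MulEquiv.irreducible_iff (Bivariate.swap (R := k))] at h
  convert h using 1
  simp only [map_neg, map_sub, map_pow, Bivariate.swap_X, Bivariate.swap_Y]
  ring

theorem irreducible_X_pow_sub_X_sub_C_gen_pow {k L : Type*} [Field k] [Field L] [Algebra k L]
    {y : L} (hy : Transcendental k y) {q m : ℕ} (hq : 1 < q) (hm : 0 < m) :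
    Irreducible (X ^ q - X - C (AdjoinSimple.gen k y ^ m) : k⟮y⟯[X]) := by
  have hmon : (X ^ q - X - C (X ^ m) : k[X][X]).Monic := by
    rw [sub_sub]
    exact monic_X_pow_sub (by compute_degree!)
  have h := (hmon.irreducible_iff_irreducible_map_fraction_map (K := RatFunc k)).1
    (irreducible_X_pow_sub_X_sub_C_X_pow hq hm)
  rw [← MulEquiv.irreducible_iff (mapEquiv (RatFunc.algEquivOfTranscendental y hy).toRingEquiv)]
    at h
  convert h using 1
  have hX : RatFunc.algEquivOfTranscendental y hy RatFunc.X = AdjoinSimple.gen k y :=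
    Subtype.ext (RatFunc.algEquivOfTranscendental_X y hy)
  simp [hX]

/-- An Artin–Schreier extension `K(s)`, `s ^ q - s = a` with `q = p ^ n`, of a field `K` containing
the field with `q` elements is Galois with group `𝔽_q` as soon as `X ^ q - X - a` is irreducible. -/
theorem isGalois_and_nonempty_mulEquiv_of_irreducible {K L : Type*} [Field K] [Field L]
    [Algebra K L] {p : ℕ} [Fact p.Prime] [CharP K p] {n : ℕ} (hn : n ≠ 0)
    (ι : GaloisField p n →+* K) {a : K} (ha : Irreducible (X ^ p ^ n - X - C a : K[X]))
    {s : L} (hs : s ^ p ^ n - s = algebraMap K L a) (hgen : K⟮s⟯ = ⊤) :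
    FiniteDimensional K L ∧ IsGalois K L ∧
      Nonempty ((L ≃ₐ[K] L) ≃* Multiplicative (GaloisField p n)) := by
  have : CharP L p := charP_of_injective_algebraMap' K p
  have hq : 1 < p ^ n := Nat.one_lt_pow hn (Fact.out : p.Prime).one_lt
  set P : K[X] := X ^ p ^ n - X - C a with hP
  have hmon : P.Monic := by
    rw [hP, sub_sub]
    exact monic_X_pow_sub (by compute_degree!)
  have hdeg : P.natDegree = p ^ n := by
    rw [hP, sub_sub]
    exact natDegree_sub_eq_left_of_natDegree_lt (by compute_degree!) |>.trans (natDegree_X_pow _)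
  have hroot : aeval s P = 0 := by simp [hP, hs]
  have hmin : P = minpoly K s := minpoly.eq_of_irreducible_of_monic ha hroot hmon
  have hsplit : (X ^ p ^ n - X : (GaloisField p n)[X]).Splits := by
    simpa [GaloisField.card p n hn] using
      FiniteField.splits_X_pow_nat_card_sub_X p (K := GaloisField p n)
  let j : GaloisField p n →+* L := (algebraMap K L).comp ι
  have hPsplit : (P.map (algebraMap K L)).Splits := by
    have h : P.map (algebraMap K L) = ((X ^ p ^ n - X : (GaloisField p n)[X]).map j).comp
        (X - C s) := by
      simp only [hP, Polynomial.map_sub, Polynomial.map_pow, map_X, map_C, sub_comp, pow_comp,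
        X_comp, sub_pow_expChar_pow, ← hs, C_pow, C_sub]
      ring
    exact h ▸ (hsplit.map j).comp_X_sub_C s
  have hsep : P.Separable := by
    rw [separable_def, hP]
    have : derivative (X ^ p ^ n - X - C a : K[X]) = -1 := by
      simp [derivative_X_pow, hn]
    rw [this]
    exact isCoprime_one_right.neg_right
  have : P.IsSplittingField K L := by
    refine isSplittingField_iff_intermediateField.2 ⟨hPsplit, top_le_iff.1 (hgen ▸ ?_)⟩
    exact adjoin.mono _ _ _ (Set.singleton_subset_iff.2 (mem_rootSet.2 ⟨hmon.ne_zero, hroot⟩))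
  have hfin : FiniteDimensional K L := IsSplittingField.finiteDimensional L P
  have hgal : IsGalois K L := IsGalois.of_separable_splitting_field hsep
  refine ⟨hfin, hgal, ?_⟩
  have hrank : Module.finrank K L = p ^ n := by
    rw [← finrank_top', ← hgen, adjoin.finrank ⟨P, hmon, hroot⟩, ← hmin, hdeg]
  have hmem (σ : L ≃ₐ[K] L) : ∃ c, j c = σ s - s := by
    refine hsplit.mem_range_of_isRoot (monic_X_pow_sub (by compute_degree!)).ne_zero ?_
    have : (σ s) ^ p ^ n - σ s = s ^ p ^ n - s := by
      rw [← map_pow, ← map_sub, hs, AlgEquiv.commutes]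
    rw [IsRoot.def, Polynomial.map_sub, Polynomial.map_pow, map_X, eval_sub, eval_pow, eval_X,
      sub_pow_expChar_pow]
    linear_combination this
  choose g hg using hmem
  have hj (σ : L ≃ₐ[K] L) (c) : σ (j c) = j c := σ.commutes (ι c)
  let φ : (L ≃ₐ[K] L) →* Multiplicative (GaloisField p n) :=
    MonoidHom.mk' (fun σ => .ofAdd (g σ)) fun σ τ => by
      rw [← ofAdd_add]
      congr 1
      apply j.injective
      have := hj σ (g τ)
      rw [hg, map_sub] at this
      rw [map_add, hg, hg, hg, AlgEquiv.mul_apply]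
      linear_combination this
  have hφ : Function.Injective φ := fun σ τ h => by
    have h : g σ = g τ := h
    have hst : σ s = τ s := by
      have := congrArg j h
      rw [hg, hg] at this
      linear_combination this
    have : (σ : L →ₐ[K] L) = τ := by
      refine AlgHom.ext_of_adjoin_eq_top (s := {s}) ?_ (by simpa using hst)
      rw [← adjoin_simple_toSubalgebra_of_isAlgebraic ⟨P, hmon.ne_zero, hroot⟩, hgen,
        top_toSubalgebra]
    exact AlgEquiv.ext fun x => DFunLike.congr_fun this x
  refine ⟨MulEquiv.ofBijective φ ((Nat.bijective_iff_injective_and_card φ).2 ⟨hφ, ?_⟩)⟩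
  rw [IsGalois.card_aut_eq_finrank, hrank]
  exact (GaloisField.card p n hn).symm

/-- Let `F' = k(t, y)` be the function field of the curve
`y^(q+1) = t^q - 2 t^((q+1)/2) + t`.  Then `F'` is a finite Galois extension of `k⟮y⟯`,
and `Gal(F'/k⟮y⟯)` is isomorphic to the additive group of the finite field with `q = pⁿ`
elements. -/
theorem stmt_14
    (k : Type*) [Field k] [IsAlgClosed k]
    (p : ℕ) [Fact p.Prime] (hp2 : p ≠ 2) [CharP k p]
    (n q : ℕ) (hq : q = p ^ n) (hq5 : 5 ≤ q)
    (F' : Type*) [Field F'] [Algebra k F']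
    (t y : F') (ht : Transcendental k t)
    (hty : y ^ (q + 1) = t ^ q - 2 * t ^ ((q + 1) / 2) + t)
    (hgen : adjoin k {t, y} = ⊤) :
    FiniteDimensional k⟮y⟯ F' ∧ IsGalois k⟮y⟯ F' ∧
      Nonempty ((F' ≃ₐ[k⟮y⟯] F') ≃* Multiplicative (GaloisField p n)) := by
  have hodd : Odd q := hq ▸ ((Fact.out : p.Prime).odd_of_ne_two hp2).pow
  obtain ⟨l, hl⟩ := hodd
  have hm : (q + 1) / 2 = l + 1 := by lia
  rw [hm] at hty
  have hn : n ≠ 0 := by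
    rintro rfl
    simp_all
  have hy : Transcendental k y := by
    have hf : Transcendental k (aeval t (X ^ q - C 2 * X ^ (l + 1) + X : k[X])) := by
      have hd : (X ^ q - C 2 * X ^ (l + 1) + X : k[X]).natDegree = q := by
        have h1 : q ≠ 1 := by lia
        have h2 : q ≠ l + 1 := by lia
        compute_degree
        · simp [h1.symm, h2]
        all_goals lia
      have h0 : (X ^ q - C 2 * X ^ (l + 1) + X : k[X]).natDegree ≠ 0 := by lia
      exact ht.aeval _ h0 (by simpa using ne_zero_of_natDegree_gt (Nat.pos_of_ne_zero h0))
    have h : aeval t (X ^ q - C 2 * X ^ (l + 1) + X : k[X]) = y ^ (q + 1) := by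
      simp [hty, map_ofNat]
    rw [h] at hf
    exact fun hy => hf (hy.pow _)
  have hy0 : y ^ (l + 1) ≠ 0 := pow_ne_zero _ fun h => hy (h ▸ isAlgebraic_zero)
  set s : F' := (t ^ (l + 1) - t) / y ^ (l + 1)
  have hsy : s * y ^ (l + 1) = t ^ (l + 1) - t := div_mul_cancel₀ _ hy0
  have hty : (y ^ (l + 1)) ^ 2 = t ^ q - 2 * t ^ (l + 1) + t := by
    rw [← hty, ← pow_mul]
    congr 1
    lia
  have hs2 : s ^ 2 = t := by
    apply mul_right_cancel₀ (pow_ne_zero 2 hy0)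
    rw [← mul_pow, hsy, hty, hl]
    ring
  have hs : s ^ p ^ n - s = algebraMap k⟮y⟯ F' (AdjoinSimple.gen k y ^ (l + 1)) := by
    rw [map_pow, AdjoinSimple.algebraMap_gen, ← hq]
    apply mul_right_cancel₀ hy0
    have : s ^ q = t ^ l * s := by rw [hl, pow_succ, pow_mul, hs2]
    rw [this, ← sq, hty, hl]
    linear_combination (t ^ l - 1) * hsy
  have htop : k⟮y⟯⟮s⟯ = ⊤ := by
    rw [← restrictScalars_eq_top_iff (K := k), ← top_le_iff, ← hgen, adjoin_le_iff]
    rintro x (rfl | rfl)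
    · rw [← hs2]
      exact pow_mem (mem_adjoin_simple_self k⟮y⟯ s) 2
    · exact IntermediateField.algebraMap_mem k⟮x⟯⟮s⟯ (AdjoinSimple.gen k x)
  have : CharP k⟮y⟯ p := charP_of_injective_algebraMap' k p
  let := ZMod.algebra k p
  let ι : GaloisField p n →+* k⟮y⟯ :=
    (algebraMap k k⟮y⟯).comp (IsAlgClosed.lift (R := ZMod p) : GaloisField p n →ₐ[ZMod p] k)
  exact isGalois_and_nonempty_mulEquiv_of_irreducible hn ι
    (irreducible_X_pow_sub_X_sub_C_gen_pow hy (by lia) (by lia)) hs htop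
end
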